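/- arXiv:2601.21209 — 8 statements merged into one kernel-verified Lean document; each statement's English description precedes it below -/
import Mathlib

section
/- The set C^sep_{A_K} is uncountable. In fact, already the set of roots in A_K of the single polynomial x² − x ∈ K[x] is uncountable. -/
set_option synthInstance.maxHeartbeats 1000000
set_option maxHeartbeats 1000000

open Polynomial

noncomputable section

variable (Fq : Type) [Field Fq] [Fintype Fq]

/-- Monic irreducible elements of `R = Fq[θ]`. -/
abbrev MonicIrr : Type := {P : Polynomial Fq // P.Monic ∧ Irreducible P}

/-- The residue ring `R/(P)`, a finite field with `q ^ deg P` elements. -/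
abbrev ResField (P : MonicIrr Fq) : Type :=
  Polynomial Fq ⧸ Ideal.span ({P.1} : Set (Polynomial Fq))

/-- The ideal of families `(a_P)_P` with only finitely many nonzero coordinates. -/
def finIdeal : Ideal (∀ P : MonicIrr Fq, ResField Fq P) where
  carrier := {f | {P : MonicIrr Fq | f P ≠ 0}.Finite}
  zero_mem' := by simp
  add_mem' := by
    intro f g hf hg
    refine Set.Finite.subset (hf.union hg) fun P hP => ?_
    simp only [Set.mem_setOf_eq, Set.mem_union, ne_eq] at hP ⊢
    by_contra hc
    push_neg at hc
    exact hP (by rw [Pi.add_apply, hc.1, hc.2, add_zero])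
  smul_mem' := by
    intro c f hf
    refine Set.Finite.subset hf fun P hP => ?_
    simp only [Set.mem_setOf_eq, ne_eq] at hP ⊢
    intro h
    exact hP (by rw [smul_eq_mul, Pi.mul_apply, h, mul_zero])

/-- The ring `A_K = (∏_P R/(P)) / (⊕_P R/(P))`. -/
abbrev AK : Type := (∀ P : MonicIrr Fq, ResField Fq P) ⧸ finIdeal Fq

/-- The canonical projection onto `A_K`. -/
def mkAK : (∀ P : MonicIrr Fq, ResField Fq P) → AK Fq :=
  fun a => Ideal.Quotient.mk (finIdeal Fq) a

/-- `x ∈ K` is `P`-integral: `P` does not divide its denominator. -/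
def PIntegral (x : RatFunc Fq) (P : MonicIrr Fq) : Prop :=
  ∃ a b : Polynomial Fq, ¬ P.1 ∣ b ∧
    x * algebraMap (Polynomial Fq) (RatFunc Fq) b = algebraMap (Polynomial Fq) (RatFunc Fq) a

/-- `x mod P = c` in `R/(P)` (for `P`-integral `x ∈ K`). -/
def ModPEq (x : RatFunc Fq) (P : MonicIrr Fq) (c : ResField Fq P) : Prop :=
  ∃ a b : Polynomial Fq, ¬ P.1 ∣ b ∧
    x * algebraMap (Polynomial Fq) (RatFunc Fq) b = algebraMap (Polynomial Fq) (RatFunc Fq) a ∧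
    Ideal.Quotient.mk (Ideal.span ({P.1} : Set (Polynomial Fq))) a
      = c * Ideal.Quotient.mk (Ideal.span ({P.1} : Set (Polynomial Fq))) b

/-- `α ∈ A_K` is the diagonal image of `x ∈ K`. -/
def IsDiag (x : RatFunc Fq) (α : AK Fq) : Prop :=
  ∃ a : ∀ P : MonicIrr Fq, ResField Fq P,
    mkAK Fq a = α ∧ {P : MonicIrr Fq | ¬ ModPEq Fq x P (a P)}.Finite

/-- `f ∈ K[x]` is a product of (finitely many) separable polynomials. -/
def ProdSep (f : Polynomial (RatFunc Fq)) : Prop :=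
  ∃ s : Multiset (Polynomial (RatFunc Fq)), (∀ g ∈ s, g.Separable) ∧ f = s.prod

/-- `f(α) = 0` in `A_K`, the coefficients of `f` being mapped diagonally into `A_K`. -/
def PolyRoot (f : Polynomial (RatFunc Fq)) (α : AK Fq) : Prop :=
  ∃ d : ℕ → AK Fq, (∀ j : ℕ, IsDiag Fq (f.coeff j) (d j)) ∧
    (∑ j ∈ Finset.range (f.natDegree + 1), d j * α ^ j) = 0

/-- `(a_n)_{n ≥ 1}` is a linear recurrent sequence over `K` whose eigen polynomial is a
product of separable polynomials. -/
def IsLinRecSep (a : ℕ → RatFunc Fq) : Prop :=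
  ∃ (m : ℕ) (c : Fin (m + 1) → RatFunc Fq),
    c (Fin.last m) ≠ 0 ∧
    (∀ n : ℕ, 1 ≤ n → a (n + (m + 1)) = ∑ i : Fin (m + 1), c i * a (n + m - i.1)) ∧
    ProdSep Fq ((X : Polynomial (RatFunc Fq)) ^ (m + 1) -
      ∑ i : Fin (m + 1), Polynomial.C (c i) * X ^ (m - i.1))

omit [Fintype Fq] in
/-- There are infinitely many monic irreducible polynomials over a field: the algebraic closure is
infinite, and each of its elements is a root of one of them. -/
theorem infinite_monicIrr : Infinite (MonicIrr Fq) := by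
  by_contra h
  rw [not_infinite_iff_finite] at h
  have hcover : (Set.univ : Set (AlgebraicClosure Fq)) =
      ⋃ P : MonicIrr Fq, P.1.rootSet (AlgebraicClosure Fq) := by
    refine (Set.eq_univ_of_forall fun x => ?_).symm
    have hx : IsIntegral Fq x := Algebra.IsIntegral.isIntegral x
    refine Set.mem_iUnion.2 ⟨⟨minpoly Fq x, minpoly.monic hx, minpoly.irreducible hx⟩, ?_⟩
    exact Polynomial.mem_rootSet.2 ⟨minpoly.ne_zero hx, minpoly.aeval Fq x⟩
  have hfin : (Set.univ : Set (AlgebraicClosure Fq)).Finite := by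
    rw [hcover]
    exact Set.finite_iUnion fun P => Polynomial.rootSet_finite _ _
  exact Set.infinite_univ hfin

theorem countable_monicIrr : Countable (MonicIrr Fq) := by
  have : Countable (Polynomial Fq) :=
    Cardinal.mk_le_aleph0_iff.1 <| Polynomial.cardinalMk_le_max.trans <|
      max_le Cardinal.mk_le_aleph0 le_rfl
  infer_instance

omit [Fintype Fq] in
theorem resField_one_ne_zero (P : MonicIrr Fq) : (1 : ResField Fq P) ≠ 0 := by
  have : Nontrivial (ResField Fq P) := Ideal.Quotient.nontrivial_iff.2 fun h =>
    P.2.2.not_isUnit (Ideal.span_singleton_eq_top.1 h)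
  exact one_ne_zero

open Classical in
/-- The class in `A_K` of the indicator family of a set of primes. -/
def indicatorAK (S : Set (MonicIrr Fq)) : AK Fq :=
  mkAK Fq fun P => if P ∈ S then 1 else 0

omit [Fintype Fq] in
theorem indicatorAK_isIdempotentElem (S : Set (MonicIrr Fq)) :
    IsIdempotentElem (indicatorAK Fq S) := by
  classical
  rw [IsIdempotentElem, indicatorAK, mkAK, ← map_mul]
  congr 1
  ext1 P
  by_cases h : P ∈ S <;> simp [h]

omit [Fintype Fq] in
open scoped symmDiff in
theorem finite_symmDiff_of_indicatorAK_eq {S T : Set (MonicIrr Fq)}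
    (h : indicatorAK Fq S = indicatorAK Fq T) : (S ∆ T).Finite := by
  classical
  refine Set.Finite.subset (Ideal.Quotient.eq.1 h) fun P hP => ?_
  have h1 := resField_one_ne_zero Fq P
  rcases hP with ⟨hS, hT⟩ | ⟨hT, hS⟩ <;> simp [hS, hT, h1]

open scoped symmDiff in
theorem not_countable_idempotents : ¬ {α : AK Fq | α ^ 2 - α = 0}.Countable := by
  intro h
  have := infinite_monicIrr Fq
  have := countable_monicIrr Fq
  have hfiber (α : AK Fq) : (indicatorAK Fq ⁻¹' {α}).Countable := by
    rcases (indicatorAK Fq ⁻¹' {α}).eq_empty_or_nonempty with he | ⟨S, hS⟩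
    · simp [he]
    · refine Set.Countable.mono (fun T hT => ?_)
        ((Set.Countable.ofPred_finite (α := MonicIrr Fq)).image fun F => S ∆ F)
      refine ⟨S ∆ T, finite_symmDiff_of_indicatorAK_eq Fq (hS.trans hT.symm), ?_⟩
      exact symmDiff_symmDiff_cancel_left S T
  have huniv : (Set.univ : Set (Set (MonicIrr Fq))).Countable := by
    refine (h.biUnion fun α _ => hfiber α).mono fun S _ => ?_
    refine Set.mem_biUnion (x := indicatorAK Fq S) ?_ rfl
    rw [Set.mem_ofPred_eq, pow_two, indicatorAK_isIdempotentElem, sub_self]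
  obtain ⟨f, hf⟩ := (Set.countable_univ_iff.1 huniv).exists_injective_nat
  exact Function.cantor_injective _ ((Infinite.natEmbedding (MonicIrr Fq)).injective.comp hf)

omit [Fintype Fq] in
theorem isDiag_algebraMap (p : Polynomial Fq) :
    IsDiag Fq (algebraMap (Polynomial Fq) (RatFunc Fq) p)
      (mkAK Fq fun _ => Ideal.Quotient.mk _ p) := by
  refine ⟨_, rfl, ?_⟩
  convert Set.finite_empty
  refine Set.eq_empty_of_forall_notMem fun P hP => hP ⟨p, 1, ?_, by simp, by simp⟩
  exact fun hd => P.2.2.not_isUnit (isUnit_of_dvd_one hd)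

omit [Fintype Fq] in
theorem prodSep_X_sq_sub_X : ProdSep Fq (X ^ 2 - X) := by
  refine ⟨{X, X - C 1}, ?_, ?_⟩
  · simp only [Multiset.insert_eq_cons, Multiset.mem_cons, Multiset.mem_singleton]
    rintro g (rfl | rfl)
    exacts [separable_X, separable_X_sub_C]
  · simp only [Multiset.insert_eq_cons, Multiset.prod_cons, Multiset.prod_singleton, map_one]
    ring

theorem natDegree_X_sq_sub_X {K : Type*} [Field K] : (X ^ 2 - X : Polynomial K).natDegree = 2 := by
  compute_degree!

omit [Fintype Fq] in
theorem polyRoot_X_sq_sub_X {α : AK Fq} (h : α ^ 2 - α = 0) : PolyRoot Fq (X ^ 2 - X) α := by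
  refine ⟨fun j => mkAK Fq fun _ => Ideal.Quotient.mk _ ((X ^ 2 - X : Polynomial Fq[X]).coeff j),
    fun j => ?_, ?_⟩
  · convert isDiag_algebraMap Fq ((X ^ 2 - X : Polynomial Fq[X]).coeff j) using 1
    rw [← coeff_map]
    simp
  · have h0 : (mkAK Fq fun _ => 0) = 0 := map_zero (Ideal.Quotient.mk (finIdeal Fq))
    have h1 : (mkAK Fq fun _ => 1) = 1 := map_one (Ideal.Quotient.mk (finIdeal Fq))
    have h2 : (mkAK Fq fun _ => -1) = -1 := by
      rw [← h1]; exact map_neg (Ideal.Quotient.mk (finIdeal Fq)) 1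
    rw [natDegree_X_sq_sub_X]
    simp [Finset.sum_range_succ, coeff_X, coeff_X_pow, h0, h1, h2]
    linear_combination h

/-- `C^sep_{A_K}` is uncountable; in fact already the set of roots of `x² - x`
in `A_K` is uncountable. -/
theorem statement8 :
    ¬ ({α : AK Fq | ∃ f : Polynomial (RatFunc Fq),
          f ≠ 0 ∧ ProdSep Fq f ∧ PolyRoot Fq f α}.Countable) ∧
    ¬ ({α : AK Fq | α ^ 2 - α = 0}.Countable) := by
  refine ⟨fun h => not_countable_idempotents Fq (h.mono fun α hα => ?_),
    not_countable_idempotents Fq⟩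
  refine ⟨X ^ 2 - X, ?_, prodSep_X_sq_sub_X Fq, polyRoot_X_sq_sub_X Fq hα⟩
  exact ne_zero_of_natDegree_gt (n := 1) (by rw [natDegree_X_sq_sub_X]; norm_num)
end
end

section
/- There exists α ∈ A_K such that α^q equals the diagonal image of θ in A_K and α is not a root of any nonzero polynomial in K[x] that is a product of separable polynomials. Consequently C^sep_{A_K} is a proper subset of C^alg_{A_K}. -/
set_option synthInstance.maxHeartbeats 1000000
set_option maxHeartbeats 1000000

open Polynomial

noncomputable section

variable (Fq : Type) [Field Fq] [Fintype Fq]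

theorem RingHom.mem_range_of_separable {F E : Type*} [Field F] [Field E] (φ : F →+* E)
    (p : ℕ) [ExpChar F p] {x : E} {g : F[X]} (hg : g.Separable) (h : eval₂ φ x g = 0)
    {n : ℕ} (hx : x ^ p ^ n ∈ φ.range) : x ∈ φ.range := by
  let := φ.toAlgebra
  have h1 : x ∈ perfectClosure F E := (mem_perfectClosure_iff_pow_mem p).2 ⟨n, hx⟩
  have h2 : x ∈ separableClosure F E :=
    mem_separableClosure_iff.2 (hg.of_dvd (minpoly.dvd F x h))
  have h3 : x ∈ separableClosure F E ⊓ perfectClosure F E := ⟨h2, h1⟩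
  rw [separableClosure_inf_perfectClosure] at h3
  exact IntermediateField.mem_bot.1 h3

theorem RatFunc.pow_ne_X {F : Type*} [Field F] {n : ℕ} (hn : 1 < n) (y : RatFunc F) :
    y ^ n ≠ RatFunc.X := by
  intro h
  have hint : IsIntegral F[X] y := by
    refine IsIntegral.of_pow (n := n) (by omega) ?_
    rw [h, ← RatFunc.algebraMap_X]
    exact isIntegral_algebraMap
  obtain ⟨z, rfl⟩ := IsIntegrallyClosed.isIntegral_iff.1 hint
  rw [← RatFunc.algebraMap_X, ← map_pow] at h
  have h2 := congrArg natDegree (RatFunc.algebraMap_injective F h)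
  rw [natDegree_pow, natDegree_X] at h2
  exact hn.ne' (Nat.eq_one_of_mul_eq_one_right h2)

/-- A nonzero polynomial cannot be divisible by cofinitely many monic irreducibles. -/
theorem eq_zero_of_finite_not_dvd (N : Fq[X]) (h : {P : MonicIrr Fq | ¬ P.1 ∣ N}.Finite) :
    N = 0 := by
  by_contra hN
  set M : Fq[X] := N * ∏ P ∈ h.toFinset, P.1
  have hM0 : M ≠ 0 := mul_ne_zero hN (Finset.prod_ne_zero_iff.2 fun P _ => P.2.1.ne_zero)
  have hu : ¬ IsUnit (M * X + 1) := by
    intro hu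
    have h1 := natDegree_eq_zero_of_isUnit hu
    rw [← C_1, natDegree_add_C, natDegree_mul_X hM0] at h1
    omega
  obtain ⟨Q, hmonic, hirr, hdvd⟩ := Polynomial.exists_monic_irreducible_factor _ hu
  have hQM : Q ∣ M := by
    by_cases hd : Q ∣ N
    · exact hd.mul_right _
    · exact (Finset.dvd_prod_of_mem (fun P : MonicIrr Fq => P.1)
        (h.mem_toFinset.2 (show (⟨Q, hmonic, hirr⟩ : MonicIrr Fq) ∈ _ from hd))).mul_left _
  exact hirr.not_isUnit
    (isUnit_of_dvd_one ((dvd_add_right (hQM.mul_right X)).1 hdvd))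

instance (P : MonicIrr Fq) : (Ideal.span ({P.1} : Set Fq[X])).IsMaximal :=
  PrincipalIdealRing.isMaximal_of_irreducible P.2.2

instance (P : MonicIrr Fq) : Finite (ResField Fq P) :=
  have := P.2.1.finite_quotient
  Module.finite_of_finite Fq

theorem exists_pow_card_eq (P : MonicIrr Fq) (x : ResField Fq P) :
    ∃ y : ResField Fq P, y ^ Fintype.card Fq = x := by
  let := Ideal.Quotient.field (Ideal.span ({P.1} : Set Fq[X]))
  exact Finite.surjective_of_injective
    (f := FiniteField.frobeniusAlgHom Fq (ResField Fq P)) (RingHom.injective _) x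

/-- The diagonal ring homomorphism `Fq[θ] → A_K`. -/
def diagHom : Fq[X] →+* AK Fq :=
  (Ideal.Quotient.mk (finIdeal Fq)).comp
    (RingHom.pi fun P : MonicIrr Fq => Ideal.Quotient.mk (Ideal.span ({P.1} : Set Fq[X])))

theorem isDiag_diagHom (p : Fq[X]) :
    IsDiag Fq (algebraMap Fq[X] (RatFunc Fq) p) (diagHom Fq p) := by
  refine ⟨_, rfl, ?_⟩
  convert Set.finite_empty
  refine Set.eq_empty_of_forall_notMem fun P hP => hP ⟨p, 1, ?_, by simp, ?_⟩
  · exact fun h => P.2.2.not_isUnit (isUnit_of_dvd_one h)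
  · rw [map_one, mul_one]
    rfl

theorem polyRoot_map {F : Fq[X][X]} {α : AK Fq} (h : eval₂ (diagHom Fq) α F = 0) :
    PolyRoot Fq (F.map (algebraMap Fq[X] (RatFunc Fq))) α := by
  refine ⟨fun j => diagHom Fq (F.coeff j), fun j => ?_, ?_⟩
  · rw [coeff_map]
    exact isDiag_diagHom Fq _
  · rw [natDegree_map_eq_of_injective (RatFunc.algebraMap_injective Fq), ← eval₂_eq_sum_range, h]

theorem ModPEq.mk_eq {x : RatFunc Fq} {P : MonicIrr Fq} {c : ResField Fq P}
    (h : ModPEq Fq x P c) {n b : Fq[X]}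
    (hn : algebraMap Fq[X] (RatFunc Fq) n = algebraMap Fq[X] (RatFunc Fq) b * x) :
    Ideal.Quotient.mk (Ideal.span ({P.1} : Set Fq[X])) n =
      Ideal.Quotient.mk (Ideal.span ({P.1} : Set Fq[X])) b * c := by
  obtain ⟨a', b', hb', hx, hc⟩ := h
  have hz : Ideal.Quotient.mk (Ideal.span ({P.1} : Set Fq[X])) b' ≠ 0 := by
    rwa [Ne, Ideal.Quotient.eq_zero_iff_dvd]
  have h1 : n * b' = b * a' := by
    apply RatFunc.algebraMap_injective Fq
    rw [map_mul, map_mul, hn, ← hx]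
    ring
  have h2 := congrArg (Ideal.Quotient.mk (Ideal.span ({P.1} : Set Fq[X]))) h1
  rw [map_mul, map_mul, hc, ← mul_assoc] at h2
  exact mul_right_cancel₀ hz h2

theorem mkAK_eq_zero_iff {a : ∀ P : MonicIrr Fq, ResField Fq P} :
    mkAK Fq a = 0 ↔ {P : MonicIrr Fq | a P ≠ 0}.Finite :=
  Ideal.Quotient.eq_zero_iff_mem

/-- If the class of a family of `q`-th roots of `θ` is a root of `f`, then the polynomial obtained
by raising the coefficients of `f` to the `q`-th power vanishes at `θ`. -/
theorem PolyRoot.eval₂_frobenius_eq_zero {f : (RatFunc Fq)[X]}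
    {a : ∀ P : MonicIrr Fq, ResField Fq P}
    (ha : ∀ P, a P ^ Fintype.card Fq = Ideal.Quotient.mk (Ideal.span ({P.1} : Set Fq[X])) X)
    (h : PolyRoot Fq f (mkAK Fq a)) :
    eval₂ (FiniteField.frobeniusAlgHom Fq (RatFunc Fq)).toRingHom RatFunc.X f = 0 := by
  obtain ⟨d, hd, hsum⟩ := h
  choose c hc hfin using hd
  obtain ⟨b, hb⟩ := IsLocalization.exist_integer_multiples (nonZeroDivisors Fq[X])
    (Finset.range (f.natDegree + 1)) f.coeff
  have hb' : ∀ j, ∃ n : Fq[X], j ∈ Finset.range (f.natDegree + 1) →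
      algebraMap Fq[X] (RatFunc Fq) n = algebraMap Fq[X] (RatFunc Fq) b * f.coeff j := by
    intro j
    by_cases hj : j ∈ Finset.range (f.natDegree + 1)
    · obtain ⟨n, hn⟩ := hb j hj
      exact ⟨n, fun _ => by rw [hn, Algebra.smul_def]⟩
    · exact ⟨0, fun h => absurd h hj⟩
  choose n hn using hb'
  have hzero : mkAK Fq (∑ j ∈ Finset.range (f.natDegree + 1), c j * a ^ j) = 0 := by
    rw [← hsum]
    simp only [← hc, mkAK, map_sum, map_mul, map_pow]
  rw [mkAK_eq_zero_iff] at hzero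
  have key : ∑ j ∈ Finset.range (f.natDegree + 1), n j ^ Fintype.card Fq * X ^ j = 0 := by
    apply eq_zero_of_finite_not_dvd
    refine (hzero.union ((Finset.range (f.natDegree + 1)).finite_toSet.biUnion
      fun j _ => hfin j)).subset fun P hP => ?_
    by_contra hcon
    simp only [Set.mem_union, Set.mem_iUnion, Set.mem_ofPred_eq, not_or, not_exists, not_not,
      Finset.sum_apply, Pi.mul_apply, Pi.pow_apply] at hcon
    obtain ⟨h0, h1⟩ := hcon
    apply hP
    rw [← Ideal.Quotient.eq_zero_iff_dvd]
    have h2 : ∑ j ∈ Finset.range (f.natDegree + 1),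
        Ideal.Quotient.mk (Ideal.span ({P.1} : Set Fq[X])) (n j) * a P ^ j = 0 := by
      rw [← mul_zero (Ideal.Quotient.mk (Ideal.span ({P.1} : Set Fq[X])) b), ← h0, Finset.mul_sum]
      refine Finset.sum_congr rfl fun j hj => ?_
      rw [(h1 j hj).mk_eq Fq (hn j hj), mul_assoc]
    have h3 := congrArg (FiniteField.frobeniusAlgHom Fq (ResField Fq P)) h2
    simp only [map_sum, map_mul, map_pow, map_zero, FiniteField.coe_frobeniusAlgHom, ha] at h3
    simpa only [map_sum, map_mul, map_pow] using h3
  have hb0 : algebraMap Fq[X] (RatFunc Fq) b ^ Fintype.card Fq ≠ 0 :=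
    pow_ne_zero _ (IsLocalization.map_units (RatFunc Fq) b).ne_zero
  refine (mul_eq_zero.1 ?_).resolve_left hb0
  rw [eval₂_eq_sum_range, Finset.mul_sum, ← map_zero (algebraMap Fq[X] (RatFunc Fq)), ← key,
    map_sum]
  refine Finset.sum_congr rfl fun j hj => ?_
  rw [map_mul, map_pow, map_pow, hn j hj, RatFunc.algebraMap_X, mul_pow, mul_assoc]
  rfl

theorem ProdSep.eval₂_frobenius_ne_zero {f : (RatFunc Fq)[X]} (hf : ProdSep Fq f) :
    eval₂ (FiniteField.frobeniusAlgHom Fq (RatFunc Fq)).toRingHom RatFunc.X f ≠ 0 := by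
  obtain ⟨s, hs, rfl⟩ := hf
  rw [eval₂_multiset_prod]
  intro h
  obtain ⟨g, hg, h0⟩ := Multiset.mem_map.1 (Multiset.prod_eq_zero_iff.1 h)
  obtain ⟨p, hp⟩ := CharP.exists Fq
  have : Fact p.Prime := ⟨CharP.char_is_prime Fq p⟩
  have : CharP (RatFunc Fq) p := charP_of_injective_algebraMap (algebraMap Fq (RatFunc Fq)).injective p
  have : ExpChar (RatFunc Fq) p := .prime Fact.out
  obtain ⟨n, -, hn⟩ := FiniteField.card Fq p
  obtain ⟨y, hy⟩ := RingHom.mem_range_of_separable _ p (hs g hg) h0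
    (n := n) (by rw [← hn]; exact ⟨RatFunc.X, rfl⟩)
  exact RatFunc.pow_ne_X Fintype.one_lt_card y hy

/-- there is a `q`-th root of (the diagonal image of) `θ` in `A_K` which is not a
root of any nonzero product of separable polynomials over `K`; consequently
`C^sep_{A_K} ⊊ C^alg_{A_K}`. -/
theorem statement9 :
    (∃ α tθ : AK Fq, IsDiag Fq (RatFunc.X : RatFunc Fq) tθ ∧
      α ^ Fintype.card Fq = tθ ∧
      ¬ ∃ f : Polynomial (RatFunc Fq), f ≠ 0 ∧ ProdSep Fq f ∧ PolyRoot Fq f α) ∧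
    {α : AK Fq | ∃ f : Polynomial (RatFunc Fq), f ≠ 0 ∧ ProdSep Fq f ∧ PolyRoot Fq f α} ⊂
      {α : AK Fq | ∃ f : Polynomial (RatFunc Fq), f ≠ 0 ∧ PolyRoot Fq f α} := by
  choose a ha using fun P : MonicIrr Fq =>
    exists_pow_card_eq Fq P (Ideal.Quotient.mk (Ideal.span ({P.1} : Set Fq[X])) X)
  have hdiag : IsDiag Fq RatFunc.X (diagHom Fq X) := by
    simpa only [RatFunc.algebraMap_X] using isDiag_diagHom Fq X
  have hpow : mkAK Fq a ^ Fintype.card Fq = diagHom Fq X :=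
    congrArg (mkAK Fq) (funext ha)
  have hnot : ¬ ∃ f : (RatFunc Fq)[X], f ≠ 0 ∧ ProdSep Fq f ∧ PolyRoot Fq f (mkAK Fq a) :=
    fun ⟨_, _, hs, hr⟩ => hs.eval₂_frobenius_ne_zero Fq (hr.eval₂_frobenius_eq_zero Fq ha)
  refine ⟨⟨mkAK Fq a, _, hdiag, hpow, hnot⟩, fun α ⟨f, hf, _, hr⟩ => ⟨f, hf, hr⟩, fun hsub => ?_⟩
  refine hnot (hsub ⟨_, ?_, polyRoot_map Fq (F := X ^ Fintype.card Fq - C X) ?_⟩)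
  · rw [Polynomial.map_ne_zero_iff (RatFunc.algebraMap_injective Fq)]
    exact X_pow_sub_C_ne_zero Fintype.card_pos X
  · rw [eval₂_sub, eval₂_X_pow, eval₂_C, hpow, sub_self]
end
end

section
/- Let L/K be a finite Galois extension of fields with Γ = Gal(L/K), and let f ∈ K[x] be a monic polynomial that splits completely in L[x] as f(x) = ∏_i (x − α_i); set Γ_i = Gal(L/K(α_i)) ⊆ Γ and S_2 = ⋃_i { σ ∈ Γ : C_Γ(σ) ⊆ Γ_i }, where C_Γ(σ) is the centralizer of σ in Γ. Then for every g ∈ A(L), one has { σ ∈ Γ : f(g(σ)) = 0 } ⊆ S_2; moreover there exists g ∈ A(L) with { σ ∈ Γ : f(g(σ)) = 0 } = S_2. -/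
open Polynomial

/-- A map `h` from a group `G` to a `G`-set such that each `h r` is fixed by the centralizer of `r`
can be modified along conjugacy classes to a map equivariant for conjugation. -/
theorem exists_conj_equivariant {G X : Type*} [Group G] [MulAction G X] (h : G → X)
    (hfix : ∀ r τ : G, r * τ = τ * r → τ • h r = h r) :
    ∃ g : G → X, (∀ σ τ : G, g (σ * τ * σ⁻¹) = σ • g τ) ∧
      ∀ τ : G, ∃ r ρ : G, τ = ρ * r * ρ⁻¹ ∧ g τ = ρ • h r := by
  let rep : G → G := fun τ => (ConjClasses.mk τ).out
  have hrep (τ : G) : ∃ ρ : G, ρ * rep τ * ρ⁻¹ = τ :=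
    isConj_iff.mp (ConjClasses.mk_eq_mk_iff_isConj.mp (Quotient.out_eq (ConjClasses.mk τ)))
  choose ρ hρ using hrep
  refine ⟨fun τ => ρ τ • h (rep τ), fun σ τ => ?_, fun τ => ⟨rep τ, ρ τ, (hρ τ).symm, rfl⟩⟩
  have hr : rep (σ * τ * σ⁻¹) = rep τ := by
    have : ConjClasses.mk (σ * τ * σ⁻¹) = ConjClasses.mk τ :=
      ConjClasses.mk_eq_mk_iff_isConj.mpr (isConj_iff.mpr ⟨σ, rfl⟩).symm
    simp only [rep, this]
  have h1 := hρ (σ * τ * σ⁻¹)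
  have h2 := hρ τ
  simp only [hr] at h1 ⊢
  generalize ρ (σ * τ * σ⁻¹) = a at h1 ⊢
  generalize ρ τ = b at h2 ⊢
  have key : (a⁻¹ * σ * b) • h (rep τ) = h (rep τ) := by
    apply hfix
    calc rep τ * (a⁻¹ * σ * b) = a⁻¹ * (a * rep τ * a⁻¹) * σ * b := by group
      _ = a⁻¹ * (σ * (b * rep τ * b⁻¹) * σ⁻¹) * σ * b := by rw [h1, h2]
      _ = a⁻¹ * σ * b * rep τ := by group
  calc a • h (rep τ) = a • (a⁻¹ * σ * b) • h (rep τ) := by rw [key]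
    _ = σ • b • h (rep τ) := by simp [mul_smul]

theorem aeval_eq_zero_iff_of_map_eq_prod {K L : Type*} [Field K] [Field L] [Algebra K L]
    {n : ℕ} {A : Fin n → L} {f : Polynomial K}
    (hsplit : f.map (algebraMap K L) = ∏ i : Fin n, (X - C (A i))) (x : L) :
    aeval x f = 0 ↔ ∃ i, x = A i := by
  rw [← eval_map_algebraMap, hsplit, eval_prod, Finset.prod_eq_zero_iff]
  simp [sub_eq_zero]

/-- for a monic `f ∈ K[x]` splitting completely in `L` with roots `A i` and
`Γ_i = Gal(L/K(A i))`, the zero locus `{σ | f(g(σ)) = 0}` of any `g ∈ A(L)` is contained in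
`S₂ = ⋃_i {σ | C_Γ(σ) ⊆ Γ_i}`, and some `g ∈ A(L)` attains equality. -/
theorem statement13 (K L : Type) [Field K] [Field L] [Algebra K L]
    [FiniteDimensional K L] [IsGalois K L]
    (n : ℕ) (A : Fin n → L) (f : Polynomial K) (hmon : f.Monic)
    (hsplit : f.map (algebraMap K L) = ∏ i : Fin n, (X - C (A i))) :
    (∀ g : (L ≃ₐ[K] L) → L, (∀ σ τ : L ≃ₐ[K] L, g (σ * τ * σ⁻¹) = σ (g τ)) →
      {σ : L ≃ₐ[K] L | Polynomial.aeval (g σ) f = 0} ⊆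
        ⋃ i : Fin n, {σ : L ≃ₐ[K] L | ∀ τ : L ≃ₐ[K] L, σ * τ = τ * σ → τ (A i) = A i}) ∧
    (∃ g : (L ≃ₐ[K] L) → L, (∀ σ τ : L ≃ₐ[K] L, g (σ * τ * σ⁻¹) = σ (g τ)) ∧
      {σ : L ≃ₐ[K] L | Polynomial.aeval (g σ) f = 0} =
        ⋃ i : Fin n, {σ : L ≃ₐ[K] L | ∀ τ : L ≃ₐ[K] L, σ * τ = τ * σ → τ (A i) = A i}) := by
  classical
  have hroot := aeval_eq_zero_iff_of_map_eq_prod hsplit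
  have hsub : ∀ g : (L ≃ₐ[K] L) → L, (∀ σ τ : L ≃ₐ[K] L, g (σ * τ * σ⁻¹) = σ (g τ)) →
      {σ : L ≃ₐ[K] L | Polynomial.aeval (g σ) f = 0} ⊆
        ⋃ i : Fin n, {σ : L ≃ₐ[K] L | ∀ τ : L ≃ₐ[K] L, σ * τ = τ * σ → τ (A i) = A i} := by
    intro g hg σ hσ
    obtain ⟨i, hi⟩ := (hroot _).mp hσ
    refine Set.mem_iUnion.mpr ⟨i, fun τ hτ => ?_⟩
    rw [← hi, ← hg τ σ, ← hτ, mul_inv_cancel_right]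
  refine ⟨hsub, ?_⟩
  let P : (L ≃ₐ[K] L) → L → Prop := fun r x =>
    aeval x f = 0 ∧ ∀ τ : L ≃ₐ[K] L, r * τ = τ * r → τ x = x
  let h : (L ≃ₐ[K] L) → L := fun r => if hr : ∃ x, P r x then hr.choose else 0
  have hP {r : L ≃ₐ[K] L} (hr : ∃ x, P r x) : P r (h r) := by
    simpa only [h, dif_pos hr] using hr.choose_spec
  obtain ⟨g, hg, hgr⟩ := exists_conj_equivariant h fun r τ hτ => by
    by_cases hr : ∃ x, P r x
    · exact (hP hr).2 τ hτ
    · simp only [h, dif_neg hr, smul_zero]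
  refine ⟨g, hg, (hsub g hg).antisymm fun τ hτ => ?_⟩
  obtain ⟨i, hi⟩ := Set.mem_iUnion.mp hτ
  obtain ⟨r, ρ, rfl, hgτ⟩ := hgr τ
  have hr : P r (h r) := by
    refine hP ⟨ρ⁻¹ (A i), ?_, fun σ hσ => ?_⟩
    · rw [aeval_algHom_apply, (hroot _).mpr ⟨i, rfl⟩, map_zero]
    · have hfix : (ρ * σ * ρ⁻¹) (A i) = A i := hi _ (by
        calc ρ * r * ρ⁻¹ * (ρ * σ * ρ⁻¹) = ρ * (r * σ) * ρ⁻¹ := by group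
          _ = ρ * (σ * r) * ρ⁻¹ := by rw [hσ]
          _ = ρ * σ * ρ⁻¹ * (ρ * r * ρ⁻¹) := by group)
      calc σ (ρ⁻¹ (A i)) = (ρ⁻¹ * (ρ * σ * ρ⁻¹)) (A i) := by
            rw [show ρ⁻¹ * (ρ * σ * ρ⁻¹) = σ * ρ⁻¹ by group]; rfl
        _ = ρ⁻¹ (A i) := by rw [AlgEquiv.mul_apply, hfix]
  rw [Set.mem_ofPred_eq, hgτ, AlgEquiv.smul_def, aeval_algHom_apply, hr.1, map_zero]
end

section
/- Let Γ be a finite group and A a finite abelian group. Let Γ' = (Γ → A) ⋊ Γ be the wreath product, where Γ acts on the group of functions Γ → A (with pointwise operation) by (σ · f)(x) = f(σ⁻¹x), and let π : Γ' → Γ; (f, σ) ↦ σ be the projection. Let S ⊆ Γ and S' = π⁻¹(S). Then the number of elements ξ = (f, σ) ∈ S' satisfying π(C_{Γ'}(ξ)) ⊆ ⟨σ⟩ is at least (1 − |Γ|/|A|) · |S'|, i.e., |A| · |{ ξ = (f,σ) ∈ S' : π(C_{Γ'}(ξ)) ⊆ ⟨σ⟩ }| ≥ (|A| − |Γ|)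 · |S'|. -/
/-- The action of `Γ` on the group of functions `Γ → A` by left translation of the argument:
`(σ · f)(x) = f(σ⁻¹ x)`. -/
def shiftAut (Γ A : Type) [Group Γ] [CommGroup A] : Γ →* MulAut (Γ → A) where
  toFun σ :=
    { toFun := fun f x => f (σ⁻¹ * x)
      invFun := fun f x => f (σ * x)
      left_inv := fun f => funext fun x => by simp
      right_inv := fun f => funext fun x => by simp
      map_mul' := fun f g => rfl }
  map_one' := by
    ext f x
    simp
  map_mul' := fun σ τ => by
    ext f x
    simp [MulAut.mul_apply, mul_assoc]

/-- The product of the values of `f` on the subgroup `H` divided by the product of its values on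
the coset `τ⁻¹H`. -/
def cosetRatio {Γ A : Type} [Group Γ] [CommGroup A] (H : Subgroup Γ) [Fintype H] (τ : Γ)
    (f : Γ → A) : A :=
  ∏ z : H, f z / f (τ⁻¹ * z)

theorem cosetRatio_mul {Γ A : Type} [Group Γ] [CommGroup A] (H : Subgroup Γ) [Fintype H] (τ : Γ)
    (f g : Γ → A) : cosetRatio H τ (f * g) = cosetRatio H τ f * cosetRatio H τ g := by
  simp only [cosetRatio, ← Finset.prod_mul_distrib, Pi.mul_apply, mul_div_mul_comm]

theorem cosetRatio_mulSingle_one {Γ A : Type} [Group Γ] [DecidableEq Γ] [CommGroup A]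
    (H : Subgroup Γ) [Fintype H] {τ : Γ} (hτ : τ ∉ H) (a : A) :
    cosetRatio H τ (Pi.mulSingle 1 a) = a := by
  have h (z : H) : τ⁻¹ * (z : Γ) ≠ 1 := by
    intro hz
    rw [inv_mul_eq_one] at hz
    exact hτ (hz ▸ z.2)
  unfold cosetRatio
  rw [Finset.prod_eq_single 1]
  · simpa using Pi.mulSingle_eq_of_ne (M := fun _ => A) (h 1) a
  · intro z _ hz
    rw [Pi.mulSingle_eq_of_ne (h z), Pi.mulSingle_eq_of_ne (by simpa using hz), div_one]
  · simp

theorem cosetRatio_zpowers_eq_one_of_commute {Γ A : Type} [Group Γ] [CommGroup A]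
    {ξ η : (Γ → A) ⋊[shiftAut Γ A] Γ} [Fintype (Subgroup.zpowers ξ.right)]
    (h : η * ξ = ξ * η) : cosetRatio (Subgroup.zpowers ξ.right) η.right ξ.left = 1 := by
  have key (x : Γ) :
      ξ.left x / ξ.left (η.right⁻¹ * x) = η.left x / η.left (ξ.right⁻¹ * x) := by
    have hx : η.left x * ξ.left (η.right⁻¹ * x) = ξ.left x * η.left (ξ.right⁻¹ * x) :=
      congrFun (congrArg SemidirectProduct.left h) x
    rw [div_eq_div_iff_mul_eq_mul, hx]
  simp only [cosetRatio, key, Finset.prod_div_distrib]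
  rw [div_eq_one]
  exact (Equiv.prod_comp
    (Equiv.mulLeft (⟨ξ.right, Subgroup.mem_zpowers ξ.right⟩ : Subgroup.zpowers ξ.right)⁻¹)
    fun z => η.left z).symm

/-- group-theoretic lemma for the wreath product `(Γ → A) ⋊ Γ`: at least a
fraction `1 - |Γ|/|A|` of the elements `ξ = (f, σ)` of `S' = π⁻¹(S)` satisfy
`π(C_{Γ'}(ξ)) ⊆ ⟨σ⟩`. -/
theorem statement14 (Γ A : Type) [Group Γ] [Finite Γ] [CommGroup A] [Finite A] (S : Set Γ) :
    ((Nat.card A : ℤ) - (Nat.card Γ : ℤ)) *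
        (Nat.card {ξ : (Γ → A) ⋊[shiftAut Γ A] Γ // ξ.right ∈ S} : ℤ) ≤
      (Nat.card A : ℤ) *
        (Nat.card {ξ : (Γ → A) ⋊[shiftAut Γ A] Γ // ξ.right ∈ S ∧
          ∀ η : (Γ → A) ⋊[shiftAut Γ A] Γ, η * ξ = ξ * η →
            η.right ∈ Subgroup.zpowers ξ.right} : ℤ) := by
  classical
  have := Fintype.ofFinite Γ
  have : Finite ((Γ → A) ⋊[shiftAut Γ A] Γ) :=
    Finite.of_equiv _ SemidirectProduct.equivProd.symm
  let good (ξ : (Γ → A) ⋊[shiftAut Γ A] Γ) : Prop :=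
    ∀ η : (Γ → A) ⋊[shiftAut Γ A] Γ, η * ξ = ξ * η → η.right ∈ Subgroup.zpowers ξ.right
  have exists_witness (ξ : (Γ → A) ⋊[shiftAut Γ A] Γ) (hξ : ¬ good ξ) :
      ∃ τ : Γ, τ ∉ Subgroup.zpowers ξ.right ∧
        cosetRatio (Subgroup.zpowers ξ.right) τ ξ.left = 1 := by
    simp only [good, not_forall] at hξ
    obtain ⟨η, hη, hmem⟩ := hξ
    exact ⟨η.right, hmem, cosetRatio_zpowers_eq_one_of_commute hη⟩
  choose τ hτ hratio using exists_witness
  let F : A × {ξ : (Γ → A) ⋊[shiftAut Γ A] Γ // ξ.right ∈ S} →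
      (A × {ξ : (Γ → A) ⋊[shiftAut Γ A] Γ // ξ.right ∈ S ∧ good ξ}) ⊕
        (Γ × {ξ : (Γ → A) ⋊[shiftAut Γ A] Γ // ξ.right ∈ S}) := fun p =>
    if h : good p.2.1 then Sum.inl (p.1, ⟨p.2.1, p.2.2, h⟩)
    else Sum.inr (τ p.2.1 h, ⟨⟨Pi.mulSingle 1 p.1 * p.2.1.left, p.2.1.right⟩, p.2.2⟩)
  have hF : Function.Injective F := by
    rintro ⟨a, ξ, hξ⟩ ⟨b, ζ, hζ⟩ h
    by_cases h₁ : good ξ <;> by_cases h₂ : good ζ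
    · simpa [F, h₁, h₂] using h
    · simp [F, h₁, h₂] at h
    · simp [F, h₁, h₂] at h
    · simp only [F, h₁, h₂, dite_false, Sum.inr.injEq, Prod.mk.injEq, Subtype.mk.injEq,
        SemidirectProduct.ext_iff] at h
      obtain ⟨hwit, hleft, hright⟩ := h
      have ha : cosetRatio (Subgroup.zpowers ξ.right) (τ ξ h₁)
          (Pi.mulSingle 1 a * ξ.left) = a := by
        rw [cosetRatio_mul, hratio, cosetRatio_mulSingle_one _ (hτ ξ h₁), mul_one]
      have hb : cosetRatio (Subgroup.zpowers ζ.right) (τ ζ h₂)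
          (Pi.mulSingle 1 b * ζ.left) = b := by
        rw [cosetRatio_mul, hratio, cosetRatio_mulSingle_one _ (hτ ζ h₂), mul_one]
      have hab : a = b := by
        rw [← ha, ← hb, hwit, hleft]
        congr!
      subst hab
      have : ξ = ζ := SemidirectProduct.ext (mul_left_cancel hleft) hright
      subst this
      rfl
  have hcard := Nat.card_le_card_of_injective F hF
  rw [Nat.card_sum, Nat.card_prod, Nat.card_prod, Nat.card_prod] at hcard
  zify at hcard
  rw [sub_mul]
  linarith
end

section
/- Let q be a prime power, K = F_q(θ), and let L/K be a finite Galois extension with Γ = Gal(L/K). Let r be a positive integer and A = (ℤ/2ℤ)^r. Then there exists a finite Galois extension L'/K with L ⊆ L' and a group isomorphism Gal(L'/K) ≅ (Γ → A) ⋊ Γ (the wreath product, Γ acting on functions Γ → A by (σ·f)(x) = f(σ⁻¹x)) under which the restriction homomorphism Gal(L'/K) → Gal(L/K) corresponds to the projection (f, σ) ↦ σ. -/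
/-- A witness for Statement 15: a finite Galois extension `L'/K` containing `L` whose Galois
group is the wreath product `((Γ → A) ⋊ Γ)`, the restriction to `L` being the projection. -/
structure WreathWitness (Fq : Type) [Field Fq] [Fintype Fq] (L : Type) [Field L]
    [Algebra (RatFunc Fq) L] [FiniteDimensional (RatFunc Fq) L] [IsGalois (RatFunc Fq) L]
    (r : ℕ) : Type 1 where
  L' : Type
  [i1 : Field L']
  [i2 : Algebra (RatFunc Fq) L']
  [i3 : Algebra L L']
  [i4 : IsScalarTower (RatFunc Fq) L L']
  [i5 : FiniteDimensional (RatFunc Fq) L']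
  [i6 : IsGalois (RatFunc Fq) L']
  e : (L' ≃ₐ[RatFunc Fq] L') ≃*
    (((L ≃ₐ[RatFunc Fq] L) → Multiplicative (Fin r → ZMod 2))
      ⋊[shiftAut (L ≃ₐ[RatFunc Fq] L) (Multiplicative (Fin r → ZMod 2))]
      (L ≃ₐ[RatFunc Fq] L))
  he : ∀ σ : L' ≃ₐ[RatFunc Fq] L', AlgEquiv.restrictNormal σ L = (e σ).right

/-- If `y` is a root of `Y² - Y - b` over a field `F`, every element of `F(y)` has the form
`u + v y`. -/
theorem exists_eq_add_mul_of_mem_adjoin_simple {F E : Type*} [Field F] [Field E] [Algebra F E]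
    {y : E} {b : F} (hy : y ^ 2 - y = algebraMap F E b) {z : E}
    (hz : z ∈ IntermediateField.adjoin F {y}) :
    ∃ u v : F, z = algebraMap F E u + algebraMap F E v * y := by
  have h_int : IsIntegral F y := by
    refine ⟨Polynomial.X ^ 2 - Polynomial.X - Polynomial.C b, by monicity!, ?_⟩
    simp [hy]
  rw [← IntermediateField.mem_toSubalgebra,
    IntermediateField.adjoin_simple_toSubalgebra_of_isAlgebraic h_int.isAlgebraic] at hz
  induction hz using Algebra.adjoin_induction with
  | mem x hx => exact ⟨0, 1, by simpa using hx⟩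
  | algebraMap r => exact ⟨r, 0, by simp⟩
  | add x z _ _ hx hz =>
    obtain ⟨u, v, rfl⟩ := hx
    obtain ⟨u', v', rfl⟩ := hz
    exact ⟨u + u', v + v', by simp only [map_add]; ring⟩
  | mul x z _ _ hx hz =>
    obtain ⟨u, v, rfl⟩ := hx
    obtain ⟨u', v', rfl⟩ := hz
    refine ⟨u * u' + v * v' * b, u * v' + u' * v + v * v', ?_⟩
    simp only [map_add, map_mul]
    linear_combination (algebraMap F E v * algebraMap F E v') * hy

/-- If `z` lies in `F(y)` and both `y` and `z` satisfy quadratic equations `Y² - Y = b`,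
`Z² - Z = a` over `F`, then `F` contains `z` or the product `w` of `y` and `z` for the group law
`y + z - 2yz`. -/
theorem mem_or_mem_of_mem_adjoin_simple {F E : Type*} [Field F] [Field E] [Algebra F E]
    {y z : E} {a b : F} (hy : y ^ 2 - y = algebraMap F E b) (hz : z ^ 2 - z = algebraMap F E a)
    (hzy : z ∈ IntermediateField.adjoin F {y}) :
    z ∈ Set.range (algebraMap F E) ∨ y + z - 2 * y * z ∈ Set.range (algebraMap F E) := by
  obtain ⟨u, v, rfl⟩ := exists_eq_add_mul_of_mem_adjoin_simple hy hzy
  have key : algebraMap F E (2 * u * v + v ^ 2 - v) * y =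
      algebraMap F E (a - u ^ 2 - v ^ 2 * b + u) := by
    simp only [map_add, map_sub, map_mul, map_pow, map_ofNat]
    linear_combination hz - (algebraMap F E v) ^ 2 * hy
  by_cases hc : 2 * u * v + v ^ 2 - v = 0
  · rcases mul_eq_zero.1 (show v * (2 * u + v - 1) = 0 by linear_combination hc) with rfl | h
    · exact Or.inl ⟨u, by simp⟩
    · obtain rfl : v = 1 - 2 * u := by linear_combination h
      refine Or.inr ⟨u - 2 * (1 - 2 * u) * b, ?_⟩
      simp only [map_sub, map_mul, map_ofNat, map_one]
      linear_combination (2 * (1 - 2 * algebraMap F E u)) * hy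
  · have hc' : algebraMap F E (2 * u * v + v ^ 2 - v) ≠ 0 := (map_ne_zero _).2 hc
    left
    have : y = algebraMap F E ((a - u ^ 2 - v ^ 2 * b + u) / (2 * u * v + v ^ 2 - v)) := by
      rw [map_div₀, eq_div_iff hc', mul_comm, key]
    refine ⟨u + v * ((a - u ^ 2 - v ^ 2 * b + u) / (2 * u * v + v ^ 2 - v)), ?_⟩
    rw [map_add, map_mul, ← this]

open WithZero in
/-- An element with a simple pole is not of the form `z² - z`. -/
theorem Valuation.map_sq_sub_self_ne_exp_one {L : Type*} [Field L]
    (w : Valuation L (WithZero (Multiplicative ℤ))) (z : L) : w (z ^ 2 - z) ≠ exp 1 := by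
  intro h
  rcases le_or_gt (w z) 1 with hz | hz
  · have : w (z ^ 2 - z) ≤ 1 :=
      (w.map_sub _ _).trans (max_le (by rw [map_pow]; exact pow_le_one₀ zero_le hz) hz)
    rw [h, ← exp_zero, exp_le_exp] at this
    omega
  · have hlt : w z < w (z ^ 2) := by
      rw [map_pow, sq]
      exact lt_mul_of_one_lt_left (zero_lt_one.trans hz) hz
    rw [w.map_sub_eq_of_lt_left hlt, map_pow] at h
    have h0 : w z ≠ 0 := (zero_lt_one.trans hz).ne'
    have := congrArg log h
    rw [log_pow, log_exp] at this
    simp only [nsmul_eq_mul] at this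
    push_cast at this
    omega

open WithZero in
/-- Adjoining roots of `Y² - Y = b` with `b` in the maximal ideal of a discrete valuation does not
make an element with a simple pole of the form `z² - z`. -/
theorem map_ne_exp_one_of_mem_adjoin {L E J : Type*} [Field L] [Field E] [Algebra L E]
    (w : Valuation L (WithZero (Multiplicative ℤ))) {b : J → L} {y : J → E}
    (hy : ∀ j, y j ^ 2 - y j = algebraMap L E (b j)) (s : Finset J) (hs : ∀ j ∈ s, w (b j) < 1)
    {a : L} {z : E} (hz : z ^ 2 - z = algebraMap L E a)
    (hmem : z ∈ IntermediateField.adjoin L (y '' s)) : w a ≠ exp 1 := by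
  classical
  induction s using Finset.induction_on generalizing a z with
  | empty =>
    simp only [Finset.coe_empty, Set.image_empty, IntermediateField.adjoin_empty] at hmem
    obtain ⟨x, rfl⟩ := IntermediateField.mem_bot.1 hmem
    rw [← map_pow, ← map_sub] at hz
    rw [← (algebraMap L E).injective hz]
    exact w.map_sq_sub_self_ne_exp_one x
  | insert j s hj ih =>
    set F := IntermediateField.adjoin L (y '' s) with hF
    have hzF : z ∈ IntermediateField.adjoin F {y j} := by
      rw [Finset.coe_insert, Set.image_insert_eq, Set.insert_eq, Set.union_comm,
        ← IntermediateField.adjoin_adjoin_left] at hmem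
      exact hmem
    have hs' : ∀ i ∈ s, w (b i) < 1 := fun i hi => hs i (Finset.mem_insert_of_mem hi)
    have hb := hs j (Finset.mem_insert_self j s)
    rcases mem_or_mem_of_mem_adjoin_simple (F := F) (b := algebraMap L F (b j))
      (a := algebraMap L F a) (hy j) hz hzF with ⟨x, hx⟩ | ⟨x, hx⟩
    · exact ih hs' hz (hx ▸ x.2)
    · intro ha
      have h4 : w 4 ≤ 1 := by
        have := w.map_add 2 2
        have h2 := w.map_add 1 1
        norm_num at this h2
        exact this.trans h2
      have h1 : (1 : WithZero (Multiplicative ℤ)) < exp 1 := by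
        rw [← exp_zero, exp_lt_exp]; omega
      refine ih hs' (a := a + (b j + 4 * a * b j)) (z := y j + z - 2 * y j * z) ?_
        (hx ▸ x.2) ?_
      · simp only [map_add, map_mul, map_ofNat, ← hz, ← hy j]
        ring
      · rw [w.map_add_eq_of_lt_left, ha]
        rw [ha]
        refine (w.map_add _ _).trans_lt (max_lt (hb.trans h1) ?_)
        rw [map_mul, map_mul, ha]
        calc w 4 * exp 1 * w (b j) ≤ 1 * exp 1 * w (b j) := by gcongr
          _ < 1 * exp 1 * 1 := by
            gcongr
            simp
          _ = exp 1 := by simp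

/-- The action of `ZMod 2` on a ring in which `1` acts by `z ↦ 1 - z`. -/
def reflect {E : Type*} [Ring E] (c : ZMod 2) (z : E) : E := if c = 0 then z else 1 - z

theorem ZMod.two_eq_zero_or_eq_one (c : ZMod 2) : c = 0 ∨ c = 1 := by
  revert c; decide

theorem reflect_zero {E : Type*} [Ring E] (z : E) : reflect 0 z = z := by simp [reflect]

theorem reflect_one {E : Type*} [Ring E] (z : E) : reflect 1 z = 1 - z := by simp [reflect]

theorem reflect_add {E : Type*} [Ring E] (c d : ZMod 2) (z : E) :
    reflect (c + d) z = reflect c (reflect d z) := by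
  have h : (1 + 1 : ZMod 2) = 0 := by decide
  rcases c.two_eq_zero_or_eq_one with rfl | rfl <;>
    rcases d.two_eq_zero_or_eq_one with rfl | rfl <;>
    simp [reflect_zero, reflect_one, h]

theorem map_reflect {E G : Type*} [Ring E] [FunLike G E E] [RingHomClass G E E] (g : G)
    (c : ZMod 2) (z : E) : g (reflect c z) = reflect c (g z) := by
  rcases c.two_eq_zero_or_eq_one with rfl | rfl <;> simp [reflect_zero, reflect_one]

theorem reflect_injective {E : Type*} [Ring E] {z : E} (hz : z ≠ 1 - z) :
    Function.Injective fun c : ZMod 2 => reflect c z := by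
  intro c d h
  rcases c.two_eq_zero_or_eq_one with rfl | rfl <;>
    rcases d.two_eq_zero_or_eq_one with rfl | rfl <;>
    simp_all [reflect_zero, reflect_one, eq_comm]

/-- The roots of `Y² - Y = b` are `y` and `1 - y`. -/
theorem exists_eq_reflect {E : Type*} [Field E] {y z : E} (h : z ^ 2 - z = y ^ 2 - y) :
    ∃ c : ZMod 2, z = reflect c y := by
  rcases mul_eq_zero.1 (show (z - y) * (z - (1 - y)) = 0 by linear_combination h) with h | h
  · exact ⟨0, by rw [reflect_zero]; exact sub_eq_zero.1 h⟩
  · exact ⟨1, by rw [reflect_one]; exact sub_eq_zero.1 h⟩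

theorem ne_one_sub_of_notMem_intermediateField {L E : Type*} [Field L] [Field E] [Algebra L E]
    {F : IntermediateField L E} {y : E} (hy : y ∉ F) : y ≠ 1 - y := by
  intro h
  have h2 : (2 : E) * y = 1 := by linear_combination h
  refine hy ?_
  rw [eq_inv_of_mul_eq_one_right h2]
  exact F.inv_mem (ofNat_mem F 2)

/-- If the `y j` are roots of quadratic equations `Y² - Y = b j`, none of which lies in the field
generated by the others, then the conjugates of the `y j` can be prescribed independently. -/
theorem exists_algEquiv_apply_eq_reflect {L E J : Type*} [Field L] [Field E] [Algebra L E]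
    [FiniteDimensional L E] [IsGalois L E] {b : J → L} {y : J → E}
    (hy : ∀ j, y j ^ 2 - y j = algebraMap L E (b j))
    (hind : ∀ j, y j ∉ IntermediateField.adjoin L (y '' {j}ᶜ)) (s : J → ZMod 2) (t : Finset J) :
    ∃ h : E ≃ₐ[L] E, ∀ j ∈ t, h (y j) = reflect (s j) (y j) := by
  classical
  have hroot (j : J) (h : E ≃ₐ[L] E) : ∃ c : ZMod 2, h (y j) = reflect c (y j) := by
    apply exists_eq_reflect
    rw [← map_pow, ← map_sub, hy, AlgEquiv.commutes]
  induction t using Finset.induction_on with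
  | empty => exact ⟨1, by simp⟩
  | insert j t hj ih =>
    obtain ⟨h, hh⟩ := ih
    obtain ⟨c, hc⟩ := hroot j h
    by_cases hcs : c = s j
    · refine ⟨h, fun i hi => ?_⟩
      rcases Finset.mem_insert.1 hi with rfl | hi
      · rw [hc, hcs]
      · exact hh i hi
    obtain ⟨k, hk, hkj⟩ : ∃ k : E ≃ₐ[L] E,
        k ∈ (IntermediateField.adjoin L (y '' {j}ᶜ)).fixingSubgroup ∧ k (y j) ≠ y j := by
      by_contra! hcon
      apply hind j
      rw [← IsGalois.fixedField_fixingSubgroup (IntermediateField.adjoin L (y '' {j}ᶜ))]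
      exact fun k => hcon k k.2
    refine ⟨h * k, fun i hi => ?_⟩
    rw [AlgEquiv.mul_apply]
    rcases Finset.mem_insert.1 hi with rfl | hi
    · obtain ⟨d, hd⟩ := hroot i k
      have hd0 : d ≠ 0 := by
        rintro rfl
        exact hkj (by rw [hd, reflect_zero])
      have aux : ∀ c d e : ZMod 2, c ≠ e → d ≠ 0 → e = d + c := by decide
      have : s i = d + c := aux c d (s i) hcs hd0
      rw [hd, map_reflect, hc, ← reflect_add, this]
    · have hne : i ≠ j := fun h => hj (h ▸ hi)
      have : k (y i) = y i :=
        (IntermediateField.mem_fixingSubgroup_iff _ _).1 hk _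
          (IntermediateField.subset_adjoin _ _ ⟨i, hne, rfl⟩)
      rw [this, hh i hi]

/-- The Galois group of a field generated over `L` by independent roots `y σ i` of the conjugate
equations `Y² - Y = σ (a i)`. -/
theorem exists_mulEquiv_semidirectProduct {K L E : Type} [Field K] [Field L] [Field E]
    [Algebra K L] [Algebra K E] [Algebra L E] [IsScalarTower K L E] [FiniteDimensional K L]
    [IsGalois K L] [FiniteDimensional K E] [IsGalois K E] {r : ℕ} {a : Fin r → L}
    {y : (L ≃ₐ[K] L) × Fin r → E}
    (hy : ∀ p, y p ^ 2 - y p = algebraMap L E (p.1 (a p.2)))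
    (hind : ∀ p, y p ∉ IntermediateField.adjoin L (y '' {p}ᶜ))
    (htop : IntermediateField.adjoin L (Set.range y) = ⊤) :
    ∃ e : (E ≃ₐ[K] E) ≃* (((L ≃ₐ[K] L) → Multiplicative (Fin r → ZMod 2))
      ⋊[shiftAut (L ≃ₐ[K] L) (Multiplicative (Fin r → ZMod 2))] (L ≃ₐ[K] L)),
      ∀ σ : E ≃ₐ[K] E, AlgEquiv.restrictNormal σ L = (e σ).right := by
  have hinj (p) : Function.Injective fun c : ZMod 2 => reflect c (y p) :=
    reflect_injective (ne_one_sub_of_notMem_intermediateField (hind p))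
  have hex (g : E ≃ₐ[K] E) (p : (L ≃ₐ[K] L) × Fin r) :
      ∃ c : ZMod 2, g (y ((g.restrictNormal L)⁻¹ * p.1, p.2)) = reflect c (y p) := by
    apply exists_eq_reflect
    rw [← map_pow, ← map_sub, hy, hy, ← AlgEquiv.restrictNormal_commutes, ← AlgEquiv.mul_apply,
      mul_inv_cancel_left]
  choose c hc using hex
  have hmulr (g h : E ≃ₐ[K] E) :
      (g * h).restrictNormal L = g.restrictNormal L * h.restrictNormal L :=
    map_mul (AlgEquiv.restrictNormalHom L) g h
  have hmul (g h : E ≃ₐ[K] E) (p : (L ≃ₐ[K] L) × Fin r) :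
      c (g * h) p = c g p + c h ((g.restrictNormal L)⁻¹ * p.1, p.2) := by
    apply hinj p
    dsimp only
    rw [add_comm, reflect_add, ← hc g, ← map_reflect, ← hc, ← hc, hmulr, mul_inv_rev, mul_assoc,
      AlgEquiv.mul_apply]
  let Φ : (E ≃ₐ[K] E) →* (((L ≃ₐ[K] L) → Multiplicative (Fin r → ZMod 2))
      ⋊[shiftAut (L ≃ₐ[K] L) (Multiplicative (Fin r → ZMod 2))] (L ≃ₐ[K] L)) :=
    MonoidHom.mk' (fun g => ⟨fun σ => Multiplicative.ofAdd fun i => c g (σ, i),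
      g.restrictNormal L⟩) fun g h => by
        refine SemidirectProduct.ext ?_ (hmulr g h)
        funext σ
        apply Multiplicative.toAdd.injective
        funext i
        exact hmul g h (σ, i)
  have hΦinj : Function.Injective Φ := by
    rw [injective_iff_map_eq_one]
    intro g hg
    have hgr : g.restrictNormal L = 1 := congrArg SemidirectProduct.right hg
    have hgl (p : (L ≃ₐ[K] L) × Fin r) : c g p = 0 :=
      congrFun (congrArg Multiplicative.toAdd (congrFun (congrArg SemidirectProduct.left hg) p.1))
        p.2
    ext x
    have hx : x ∈ IntermediateField.adjoin L (Set.range y) := htop ▸ IntermediateField.mem_top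
    induction hx using IntermediateField.adjoin_induction with
    | mem x hx =>
      obtain ⟨p, rfl⟩ := hx
      simpa [hgr, hgl, reflect_zero] using hc g p
    | algebraMap x =>
      rw [← AlgEquiv.restrictNormal_commutes, hgr]
      rfl
    | add x z _ _ hx hz => rw [map_add, hx, hz]; rfl
    | inv x _ hx => rw [map_inv₀, hx]; rfl
    | mul x z _ _ hx hz => rw [map_mul, hx, hz]; rfl
  have hΦsurj : Function.Surjective Φ := by
    rintro ⟨f, σ⟩
    obtain ⟨g, rfl⟩ := AlgEquiv.restrictNormalHom_surjective (F := K) (K₁ := L) E σ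
    have : IsGalois L E := IsGalois.tower_top_of_isGalois K L E
    have : FiniteDimensional L E := FiniteDimensional.right K L E
    obtain ⟨h, hh⟩ := exists_algEquiv_apply_eq_reflect hy hind
      (fun p => Multiplicative.toAdd (f p.1) p.2 - c g p) Finset.univ
    have hr : (h.restrictScalars K).restrictNormal L = 1 := by
      ext x
      apply (algebraMap L E).injective
      rw [AlgEquiv.restrictNormal_commutes]
      exact h.commutes x
    have hch (p) : c (h.restrictScalars K) p = Multiplicative.toAdd (f p.1) p.2 - c g p := by
      apply hinj p
      dsimp only
      rw [← hc, ← hh p (Finset.mem_univ p), hr, inv_one, one_mul]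
      rfl
    refine ⟨h.restrictScalars K * g, SemidirectProduct.ext ?_ ?_⟩
    · funext σ
      apply Multiplicative.toAdd.injective
      funext i
      change c (h.restrictScalars K * g) (σ, i) = _
      rw [hmul, hch, hr, inv_one, one_mul]
      exact sub_add_cancel _ _
    · change (h.restrictScalars K * g).restrictNormal L = _
      rw [hmulr, hr, one_mul]
      rfl
  exact ⟨MulEquiv.ofBijective Φ ⟨hΦinj, hΦsurj⟩, fun σ => rfl⟩

/-- In a separably closed extension, `Y² - Y = b` has a root unless its discriminant `1 + 4b`
vanishes. -/
theorem exists_sq_sub_self_eq {L E : Type*} [Field L] [Field E] [Algebra L E] [IsSepClosed E]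
    {b : L} (hb : 1 + 4 * b ≠ 0) : ∃ y : E, y ^ 2 - y = algebraMap L E b := by
  have hdeg : (Polynomial.X ^ 2 - Polynomial.X - Polynomial.C b : Polynomial L).degree = 2 := by
    compute_degree!
  have hsep : (Polynomial.X ^ 2 - Polynomial.X - Polynomial.C b : Polynomial L).Separable := by
    refine ⟨Polynomial.C (1 + 4 * b)⁻¹ * -4,
      Polynomial.C (1 + 4 * b)⁻¹ * (2 * Polynomial.X - 1), ?_⟩
    have h : (Polynomial.C (1 + 4 * b)⁻¹ * (1 + 4 * Polynomial.C b) : Polynomial L) = 1 := by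
      have h4 : (4 : Polynomial L) = Polynomial.C 4 := rfl
      rw [← Polynomial.C_1, h4, ← map_mul, ← map_add, ← map_mul, inv_mul_cancel₀ hb]
    simp only [Polynomial.derivative_sub, Polynomial.derivative_X_sq, Polynomial.derivative_X,
      Polynomial.derivative_C, Polynomial.C_ofNat]
    linear_combination h
  obtain ⟨y, hy⟩ := IsSepClosed.exists_aeval_eq_zero E _ (by rw [hdeg]; decide) hsep
  exact ⟨y, by simpa [sub_eq_zero] using hy⟩

theorem Valuation.one_add_four_mul_ne_zero {L : Type*} [Field L]
    {w : Valuation L (WithZero (Multiplicative ℤ))} {b : L} (hb : w b = WithZero.exp 1) :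
    1 + 4 * b ≠ 0 := by
  intro h
  have h2 : (2 : L) ≠ 0 := by
    intro h2
    apply one_ne_zero (α := L)
    linear_combination h - 2 * b * h2
  refine w.map_sq_sub_self_ne_exp_one (2⁻¹ : L) ?_
  rw [← hb]
  congr 1
  field_simp
  linear_combination -h

/-- Elements `a i` whose conjugates have independent simple poles give rise to a wreath product
extension. -/
theorem nonempty_wreathWitness_of_valuation (Fq : Type) [Field Fq] [Fintype Fq] (L : Type)
    [Field L] [Algebra (RatFunc Fq) L] [FiniteDimensional (RatFunc Fq) L]
    [IsGalois (RatFunc Fq) L] (r : ℕ) {a : Fin r → L}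
    {w : (L ≃ₐ[RatFunc Fq] L) × Fin r → Valuation L (WithZero (Multiplicative ℤ))}
    (hw : ∀ p, w p (p.1 (a p.2)) = WithZero.exp 1)
    (hw' : ∀ p q, p ≠ q → w p (q.1 (a q.2)) < 1) : Nonempty (WreathWitness Fq L r) := by
  classical
  let Ω := SeparableClosure L
  have hsep : Algebra.IsSeparable (RatFunc Fq) Ω := Algebra.IsSeparable.trans (RatFunc Fq) L Ω
  have : IsSepClosure (RatFunc Fq) Ω := ⟨inferInstance, hsep⟩
  have : IsGalois (RatFunc Fq) Ω := inferInstance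
  have hex (p : (L ≃ₐ[RatFunc Fq] L) × Fin r) :
      ∃ y : Ω, y ^ 2 - y = algebraMap L Ω (p.1 (a p.2)) :=
    exists_sq_sub_self_eq (Valuation.one_add_four_mul_ne_zero (hw p))
  choose y hy using hex
  let E := IntermediateField.adjoin L (Set.range y)
  have hyE (p) : y p ∈ E := IntermediateField.subset_adjoin _ _ ⟨p, rfl⟩
  have hfinL : FiniteDimensional L E :=
    IntermediateField.finiteDimensional_adjoin fun x _ =>
      Algebra.IsIntegral.isIntegral (R := L) x
  have hfin : FiniteDimensional (RatFunc Fq) E := FiniteDimensional.trans (RatFunc Fq) L E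
  have hnormal : Normal (RatFunc Fq) (E.restrictScalars (RatFunc Fq)) := by
    rw [IntermediateField.normal_iff_forall_map_le']
    rintro g _ ⟨x, hx, rfl⟩
    change g x ∈ E
    replace hx : x ∈ E := hx
    induction hx using IntermediateField.adjoin_induction with
    | mem x hx =>
      obtain ⟨p, rfl⟩ := hx
      obtain ⟨c, hc⟩ : ∃ c, g (y p) = reflect c (y (g.restrictNormal L * p.1, p.2)) := by
        apply exists_eq_reflect
        rw [← map_pow, ← map_sub, hy, hy, ← AlgEquiv.restrictNormal_commutes]
        rfl
      rw [hc]
      rcases c.two_eq_zero_or_eq_one with rfl | rfl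
      · rw [reflect_zero]
        exact hyE _
      · rw [reflect_one]
        exact E.sub_mem E.one_mem (hyE _)
    | algebraMap x =>
      rw [← AlgEquiv.restrictNormal_commutes]
      exact E.algebraMap_mem _
    | add x z _ _ hx hz => rw [map_add]; exact E.add_mem hx hz
    | inv x _ hx => rw [map_inv₀]; exact E.inv_mem hx
    | mul x z _ _ hx hz => rw [map_mul]; exact E.mul_mem hx hz
  have hnormal' : Normal (RatFunc Fq) E := hnormal
  have hsepE : Algebra.IsSeparable (RatFunc Fq) E :=
    (inferInstance : Algebra.IsSeparable (RatFunc Fq) (E.restrictScalars (RatFunc Fq)))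
  have hgal : IsGalois (RatFunc Fq) E := ⟨⟩
  let y' : (L ≃ₐ[RatFunc Fq] L) × Fin r → E := fun p => ⟨y p, hyE p⟩
  have hy' (p) : y' p ^ 2 - y' p = algebraMap L E (p.1 (a p.2)) := Subtype.ext (hy p)
  have hind (p) : y' p ∉ IntermediateField.adjoin L (y' '' {p}ᶜ) := by
    intro hmem
    refine map_ne_exp_one_of_mem_adjoin (w p) hy' (Finset.univ.erase p)
      (fun q hq => hw' p q (Finset.ne_of_mem_erase hq).symm) (hy' p) ?_ (hw p)
    convert hmem
    ext
    simp
  have htop : IntermediateField.adjoin L (Set.range y') = ⊤ := by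
    apply IntermediateField.map_injective E.val
    rw [IntermediateField.adjoin_map, ← Set.range_comp, ← AlgHom.fieldRange_eq_map,
      IntermediateField.fieldRange_val]
    rfl
  obtain ⟨e, he⟩ := exists_mulEquiv_semidirectProduct hy' hind htop
  exact ⟨{ L' := E, e := e, he := he }⟩

open Polynomial IsDedekindDomain

theorem algebraMap_polynomial_injective (Fq L : Type*) [Field Fq] [Field L]
    [Algebra (RatFunc Fq) L] [Algebra Fq[X] L] [IsScalarTower Fq[X] (RatFunc Fq) L] :
    Function.Injective (algebraMap Fq[X] L) := by
  rw [IsScalarTower.algebraMap_eq Fq[X] (RatFunc Fq) L]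
  exact (algebraMap (RatFunc Fq) L).injective.comp (IsFractionRing.injective _ _)

section SplitPrimes

variable {Fq L S : Type*} [Field Fq] [Field L] [Algebra (RatFunc Fq) L]
  [FiniteDimensional (RatFunc Fq) L] [IsGalois (RatFunc Fq) L] [Algebra Fq[X] L]
  [IsScalarTower Fq[X] (RatFunc Fq) L] [CommRing S] [Algebra Fq[X] S] [Algebra S L]
  [IsScalarTower Fq[X] S L] [IsIntegralClosure S Fq[X] L]

/-- The norm of a unit is a constant. -/
theorem exists_prod_eq_of_isUnit {x : S} (hx : IsUnit x) :
    ∃ c : Fq, ∏ σ : L ≃ₐ[RatFunc Fq] L, σ (algebraMap S L x) = algebraMap Fq[X] L (C c) := by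
  have hnorm (x : S) : ∃ n : Fq[X],
      ∏ σ : L ≃ₐ[RatFunc Fq] L, σ (algebraMap S L x) = algebraMap Fq[X] L n := by
    have h : IsIntegral Fq[X] (Algebra.norm (RatFunc Fq) (algebraMap S L x)) :=
      Algebra.isIntegral_norm _ (IsIntegralClosure.isIntegral Fq[X] L x).algebraMap
    obtain ⟨n, hn⟩ := IsIntegrallyClosed.isIntegral_iff.1 h
    refine ⟨n, ?_⟩
    rw [← Algebra.norm_eq_prod_automorphisms, ← hn, ← IsScalarTower.algebraMap_apply]
  obtain ⟨u, rfl⟩ := hx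
  obtain ⟨n, hn⟩ := hnorm u
  obtain ⟨m, hm⟩ := hnorm (u⁻¹ : Sˣ)
  have hinj := algebraMap_polynomial_injective Fq L
  have hunit : n * m = 1 := by
    apply hinj
    rw [map_mul, ← hn, ← hm, ← Finset.prod_mul_distrib, map_one]
    refine Finset.prod_eq_one fun σ _ => ?_
    rw [← map_mul, ← map_mul, Units.mul_inv, map_one, map_one]
  obtain ⟨c, -, hc⟩ := Polynomial.isUnit_iff.1 (IsUnit.of_mul_eq_one m hunit)
  exact ⟨c, by rw [hn, hc]⟩

/-- For `γ ≠ 0` the elements `1 - γ t` cannot all be units, as their norms are the values of a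
nonconstant polynomial. -/
theorem exists_one_sub_mul_not_isUnit [Finite Fq] {γ : S} (hγ : algebraMap S L γ ≠ 0) :
    ∃ t : Fq[X], 1 - γ * algebraMap Fq[X] S t ≠ 0 ∧ ¬IsUnit (1 - γ * algebraMap Fq[X] S t) := by
  by_contra! hcon
  have hex (t : Fq[X]) : ∃ c : Fq, ∏ σ : L ≃ₐ[RatFunc Fq] L,
      σ (algebraMap S L (1 - γ * algebraMap Fq[X] S t)) = algebraMap Fq[X] L (C c) := by
    by_cases h : 1 - γ * algebraMap Fq[X] S t = 0
    · exact ⟨0, by rw [h]; simp⟩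
    · exact exists_prod_eq_of_isUnit (hcon t h)
  choose f hf using hex
  obtain ⟨c, hc⟩ := Finite.exists_infinite_fiber f
  have hinj := algebraMap_polynomial_injective Fq L
  let F : L[X] := ∏ σ : L ≃ₐ[RatFunc Fq] L, (C (-σ (algebraMap S L γ)) * X + C 1)
  have hne (σ : L ≃ₐ[RatFunc Fq] L) : -σ (algebraMap S L γ) ≠ 0 := by simpa using hγ
  have hdeg : F.natDegree = Fintype.card (L ≃ₐ[RatFunc Fq] L) := by
    rw [natDegree_prod]
    · rw [Finset.sum_congr rfl fun σ _ => natDegree_linear (hne σ)]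
      simp
    · intro σ _ h0
      have := natDegree_linear (b := 1) (hne σ)
      rw [h0] at this
      simp at this
  have hF : F = C (algebraMap Fq[X] L (C c)) := by
    refine eq_of_infinite_eval_eq _ _ (Set.Infinite.mono ?_
      ((Set.infinite_coe_iff.1 hc).image hinj.injOn))
    rintro _ ⟨t, rfl, rfl⟩
    change F.eval _ = _
    rw [eval_C, ← hf t, eval_prod]
    refine Finset.prod_congr rfl fun σ _ => ?_
    have : σ (algebraMap Fq[X] L t) = algebraMap Fq[X] L t := by
      rw [IsScalarTower.algebraMap_apply Fq[X] (RatFunc Fq) L, σ.commutes]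
    simp only [eval_add, eval_mul, eval_C, eval_X, eval_one, map_sub, map_one, map_mul,
      ← IsScalarTower.algebraMap_apply, this]
    ring
  rw [hF, natDegree_C] at hdeg
  exact Fintype.card_ne_zero hdeg.symm

variable (Fq L S) in
theorem exists_ne_zero_forall_galRestrict_eq_imp :
    ∃ α : S, α ≠ 0 ∧ ∀ σ, galRestrict Fq[X] (RatFunc Fq) L S σ α = α → σ = 1 := by
  have : IsDomain S := (IsIntegralClosure.algebraMap_injective S Fq[X] L).isDomain _
  obtain ⟨β, hβ⟩ := Field.exists_primitive_element (RatFunc Fq) L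
  have halg : IsAlgebraic Fq[X] β :=
    (IsFractionRing.isAlgebraic_iff Fq[X] (RatFunc Fq) L).2 (Algebra.IsAlgebraic.isAlgebraic β)
  obtain ⟨m, hm, h_int⟩ := halg.exists_integral_multiple
  have hm' : algebraMap Fq[X] (RatFunc Fq) m ≠ 0 := by
    simpa using hm
  have hsmul : m • β = algebraMap Fq[X] (RatFunc Fq) m • β := (algebraMap_smul _ _ _).symm
  obtain ⟨α, hα⟩ := IsIntegralClosure.isIntegral_iff (A := S).1 h_int
  have key (σ) (h : galRestrict Fq[X] (RatFunc Fq) L S σ α = α) : σ = 1 := by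
    have h' := congrArg (algebraMap S L) h
    rw [algebraMap_galRestrict_apply, hα, hsmul, map_smul] at h'
    have hfix : σ β = β := smul_right_injective L hm' h'
    ext x
    have hx : x ∈ IntermediateField.adjoin (RatFunc Fq) {β} := hβ ▸ IntermediateField.mem_top
    induction hx using IntermediateField.adjoin_induction with
    | mem x hx =>
      obtain rfl := hx
      exact hfix
    | algebraMap x => simp
    | add x z _ _ hx hz => rw [map_add, hx, hz]; rfl
    | inv x _ hx => rw [map_inv₀, hx]; rfl
    | mul x z _ _ hx hz => rw [map_mul, hx, hz]; rfl
  by_cases h0 : α = 0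
  · exact ⟨1, one_ne_zero, fun σ _ => key σ (by rw [h0, map_zero])⟩
  · exact ⟨α, h0, key⟩

variable (L) in
/-- Outside any finite set of primes there is a prime of `S` with trivial stabilizer in the Galois
group. -/
theorem exists_isMaximal_comap_galRestrict_ne [Finite Fq] {m : Fq[X]} (hm : m ≠ 0) :
    ∃ P : Ideal S, P.IsMaximal ∧ P ≠ ⊥ ∧ algebraMap Fq[X] S m ∉ P ∧
      ∀ σ, P.comap (galRestrict Fq[X] (RatFunc Fq) L S σ) = P → σ = 1 := by
  classical
  have : IsDomain S := (IsIntegralClosure.algebraMap_injective S Fq[X] L).isDomain _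
  obtain ⟨α, hα0, hα⟩ := exists_ne_zero_forall_galRestrict_eq_imp Fq L S
  have hinj : Function.Injective (algebraMap Fq[X] S) := by
    have hinjL := algebraMap_polynomial_injective Fq L
    rw [IsScalarTower.algebraMap_eq Fq[X] S L, RingHom.coe_comp] at hinjL
    exact hinjL.of_comp
  let D : S := ∏ σ ∈ Finset.univ.erase 1, (galRestrict Fq[X] (RatFunc Fq) L S σ α - α)
  have hD : D ≠ 0 := Finset.prod_ne_zero_iff.2 fun σ hσ h =>
    Finset.ne_of_mem_erase hσ (hα σ (sub_eq_zero.1 h))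
  have hM : algebraMap Fq[X] S m ≠ 0 := (map_ne_zero_iff _ hinj).2 hm
  have : Algebra.IsIntegral Fq[X] S := IsIntegralClosure.isIntegral_algebra Fq[X] L
  obtain ⟨n, hn0, δ, hδ⟩ := IsAlgebraic.exists_nonzero_dvd
    (Algebra.IsIntegral.isIntegral (R := Fq[X]) (α * (algebraMap Fq[X] S m * D))).isAlgebraic
    (mem_nonZeroDivisors_of_ne_zero (mul_ne_zero hα0 (mul_ne_zero hM hD)))
  have hδ0 : δ ≠ 0 := by
    rintro rfl
    exact hn0 ((map_eq_zero_iff _ hinj).1 (by rw [hδ, mul_zero]))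
  obtain ⟨t, ht0, ht⟩ := exists_one_sub_mul_not_isUnit (Fq := Fq) (L := L)
    (γ := algebraMap Fq[X] S m * D * δ) <| by
      rw [map_ne_zero_iff _ (IsIntegralClosure.algebraMap_injective S Fq[X] L)]
      exact mul_ne_zero (mul_ne_zero hM hD) hδ0
  obtain ⟨P, hP, htP⟩ := exists_max_ideal_of_mem_nonunits ht
  have hnot {x y : S} (hxy : algebraMap Fq[X] S m * D * δ * algebraMap Fq[X] S t = x * y) :
      x ∉ P := by
    intro hx
    apply hP.ne_top
    rw [Ideal.eq_top_iff_one]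
    rw [hxy] at htP
    simpa using P.add_mem htP (P.mul_mem_right y hx)
  refine ⟨P, hP, ?_, hnot (y := D * δ * algebraMap Fq[X] S t) (by ring), fun σ hσ => ?_⟩
  · rintro rfl
    exact ht0 (Ideal.mem_bot.1 htP)
  · by_contra hσ1
    refine hnot (x := D) (y := algebraMap Fq[X] S m * δ * algebraMap Fq[X] S t) (by ring) ?_
    have hmem : α - algebraMap Fq[X] S (n * t) ∈ P := by
      have : α - algebraMap Fq[X] S (n * t) =
          α * (1 - algebraMap Fq[X] S m * D * δ * algebraMap Fq[X] S t) := by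
        rw [map_mul, hδ]
        ring
      rw [this]
      exact P.mul_mem_left _ htP
    have hmem' := hmem
    rw [← hσ, Ideal.mem_comap, map_sub, AlgEquiv.commutes] at hmem'
    have hdiff : galRestrict Fq[X] (RatFunc Fq) L S σ α - α ∈ P := by
      simpa using P.sub_mem hmem' hmem
    exact P.mem_of_dvd (Finset.dvd_prod_of_mem _ (Finset.mem_erase.2 ⟨hσ1, Finset.mem_univ σ⟩))
      hdiff

variable (Fq L S) in
/-- There are arbitrarily many primes of `S` all of whose conjugates are distinct. -/
theorem exists_seq_isMaximal_comap_galRestrict [Finite Fq] :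
    ∃ P : ℕ → Ideal S, (∀ i, (P i).IsMaximal ∧ P i ≠ ⊥) ∧
      ∀ i j σ, (P i).comap (galRestrict Fq[X] (RatFunc Fq) L S σ) = P j → σ = 1 ∧ i = j := by
  classical
  have : IsDomain S := (IsIntegralClosure.algebraMap_injective S Fq[X] L).isDomain _
  obtain ⟨P, hP, hPr⟩ := exists_seq_of_forall_finset_exists
    (fun P : Ideal S => P.IsMaximal ∧ P ≠ ⊥ ∧
      ∀ σ, P.comap (galRestrict Fq[X] (RatFunc Fq) L S σ) = P → σ = 1)
    (fun P Q => ∀ σ, P.comap (galRestrict Fq[X] (RatFunc Fq) L S σ) ≠ Q) <| by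
      intro s hs
      have : Algebra.IsIntegral Fq[X] S := IsIntegralClosure.isIntegral_algebra Fq[X] L
      have hex (P : Ideal S) : ∃ n : Fq[X], n ≠ 0 ∧ (P ≠ ⊥ → algebraMap Fq[X] S n ∈ P) := by
        by_cases hP : P = ⊥
        · exact ⟨1, one_ne_zero, fun h => absurd hP h⟩
        obtain ⟨x, hx, hx0⟩ := Submodule.exists_mem_ne_zero_of_ne_bot hP
        obtain ⟨n, hn, hdvd⟩ := IsAlgebraic.exists_nonzero_dvd
          (Algebra.IsIntegral.isIntegral (R := Fq[X]) x).isAlgebraic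
          (mem_nonZeroDivisors_of_ne_zero hx0)
        exact ⟨n, hn, fun _ => P.mem_of_dvd hdvd hx⟩
      choose n hn0 hn using hex
      obtain ⟨Q, hQ, hQ0, hmQ, hQσ⟩ := exists_isMaximal_comap_galRestrict_ne (S := S) L
        (Finset.prod_ne_zero_iff.2 fun P (_ : P ∈ s) => hn0 P)
      refine ⟨Q, ⟨hQ, hQ0, hQσ⟩, fun P hPs σ h => hmQ ?_⟩
      rw [← h, Ideal.mem_comap, AlgEquiv.commutes]
      exact P.mem_of_dvd (map_dvd _ (Finset.dvd_prod_of_mem _ hPs)) (hn P (hs P hPs).2.1)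
  refine ⟨P, fun i => ⟨(hP i).1, (hP i).2.1⟩, fun i j σ h => ?_⟩
  rcases lt_trichotomy i j with hij | rfl | hij
  · exact absurd h (hPr i j hij σ)
  · exact ⟨(hP i).2.2 σ h, rfl⟩
  · refine absurd ?_ (hPr j i hij σ⁻¹)
    rw [← h]
    ext x
    rw [Ideal.mem_comap, Ideal.mem_comap, ← AlgEquiv.mul_apply, ← map_mul, mul_inv_cancel,
      map_one, AlgEquiv.one_apply]

variable (Fq L S) in
theorem exists_valuation_galRestrict [Finite Fq] [IsDedekindDomain S] [IsFractionRing S L]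
    (r : ℕ) : ∃ (a : Fin r → L) (v : Fin r → Valuation L (WithZero (Multiplicative ℤ))),
      (∀ i, v i (a i) = WithZero.exp 1) ∧
      ∀ i j (σ : L ≃ₐ[RatFunc Fq] L), (σ, i) ≠ (1, j) → v i (σ (a j)) < 1 := by
  classical
  obtain ⟨P, hP, hPr⟩ := exists_seq_isMaximal_comap_galRestrict Fq L S
  let Q (i : Fin r) : HeightOneSpectrum S := ⟨P i, (hP i).1.isPrime, (hP i).2⟩
  let I (p : (L ≃ₐ[RatFunc Fq] L) × Fin r) : Ideal S :=
    (P p.2).comap (galRestrict Fq[X] (RatFunc Fq) L S p.1)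
  have hImax (p) : (I p).IsMaximal :=
    have := (hP p.2).1
    Ideal.comap_isMaximal_of_equiv _
  have hIinj : Function.Injective I := by
    rintro ⟨σ, i⟩ ⟨τ, j⟩ h
    obtain ⟨h1, h2⟩ := hPr i j (σ * τ⁻¹) <| by
      ext x
      have hx := Ideal.ext_iff.1 h (galRestrict Fq[X] (RatFunc Fq) L S τ⁻¹ x)
      simp only [I, Ideal.mem_comap, ← AlgEquiv.mul_apply, ← map_mul, mul_inv_cancel] at hx
      simpa using hx
    rw [mul_inv_eq_one.1 h1, Fin.ext h2]
  have hcop : Pairwise (Function.onFun IsCoprime fun p => I p ^ 2) := fun p q hpq =>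
    (Ideal.isCoprime_of_isMaximal (hIinj.ne hpq)).pow
  have hex (j : Fin r) : ∃ d : S, (Q j).valuation L (algebraMap S L d) = WithZero.exp (-1) ∧
      ∀ i σ, (σ, i) ≠ (1, j) →
        galRestrict Fq[X] (RatFunc Fq) L S σ d - 1 ∈ (Q i).asIdeal := by
    obtain ⟨π, hπ⟩ := (Q j).intValuation_exists_uniformizer
    obtain ⟨d, hd⟩ := Ideal.exists_forall_sub_mem_ideal hcop
      (fun p => if p = (1, j) then π else 1)
    refine ⟨d, ?_, fun i σ hne => ?_⟩
    · have h := hd (1, j)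
      rw [if_pos rfl] at h
      have hI : I (1, j) = (Q j).asIdeal := by
        ext x
        simp [I, Q]
      rw [hI, ← HeightOneSpectrum.intValuation_le_pow_iff_mem] at h
      rw [HeightOneSpectrum.valuation_of_algebraMap, ← hπ, ← sub_add_cancel d π]
      refine Valuation.map_add_eq_of_lt_right _ (h.trans_lt ?_)
      rw [hπ, WithZero.exp_lt_exp]
      norm_num
    · have h := Ideal.pow_le_self two_ne_zero (hd (σ, i))
      rw [if_neg hne, Ideal.mem_comap, map_sub, map_one] at h
      exact h
  choose d hd hd' using hex
  refine ⟨fun j => (1 - algebraMap S L (d j)) / algebraMap S L (d j),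
    fun i => (Q i).valuation L, fun i => ?_, fun i j σ hne => ?_⟩
  · rw [map_div₀, hd, Valuation.map_one_sub_of_lt, WithZero.exp_neg, one_div, inv_inv]
    rw [hd, ← WithZero.exp_zero, WithZero.exp_lt_exp]
    norm_num
  · have h : (Q i).valuation L (algebraMap S L _) < 1 :=
      ((Q i).valuation_lt_one_iff_mem _).2 (hd' j i σ hne)
    rw [map_sub, map_one, algebraMap_galRestrict_apply] at h
    have h1 := Valuation.map_one_add_of_lt _ h
    rw [add_sub_cancel] at h1
    dsimp only
    rw [map_div₀, map_div₀, map_sub, map_one, h1, div_one, Valuation.map_sub_swap]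
    exact h

end SplitPrimes

/-- for `K = F_q(θ)`, a finite Galois extension `L/K`, and `A = (ℤ/2ℤ)^r`,
there is a finite Galois extension `L'/K` containing `L` with
`Gal(L'/K) ≅ (Γ → A) ⋊ Γ` compatibly with restriction. -/
theorem statement15 (Fq : Type) [Field Fq] [Fintype Fq] (L : Type) [Field L]
    [Algebra (RatFunc Fq) L] [FiniteDimensional (RatFunc Fq) L] [IsGalois (RatFunc Fq) L]
    (r : ℕ) (hr : 0 < r) : Nonempty (WreathWitness Fq L r) := by
  let : Algebra Fq[X] L :=
    ((algebraMap (RatFunc Fq) L).comp (algebraMap Fq[X] (RatFunc Fq))).toAlgebra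
  have : IsScalarTower Fq[X] (RatFunc Fq) L := IsScalarTower.of_algebraMap_eq fun _ => rfl
  have : IsDedekindDomain (integralClosure Fq[X] L) :=
    integralClosure.isDedekindDomain Fq[X] (RatFunc Fq) L
  have : IsFractionRing (integralClosure Fq[X] L) L :=
    integralClosure.isFractionRing_of_finite_extension (RatFunc Fq) L
  obtain ⟨a, v, hv, hv'⟩ := exists_valuation_galRestrict Fq L (integralClosure Fq[X] L) r
  refine nonempty_wreathWitness_of_valuation Fq L r (a := a)
    (w := fun p => (v p.2).comap (p.1⁻¹ : L ≃ₐ[RatFunc Fq] L)) (fun p => ?_) fun p q hpq => ?_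
  · rw [Valuation.comap_apply]
    change v p.2 ((p.1⁻¹ * p.1) (a p.2)) = _
    rw [inv_mul_cancel, AlgEquiv.one_apply, hv]
  · rw [Valuation.comap_apply]
    refine hv' p.2 q.2 (p.1⁻¹ * q.1) fun h => hpq ?_
    exact Prod.ext (inv_mul_eq_one.1 (Prod.ext_iff.1 h).1) (Prod.ext_iff.1 h).2
end

section
/- Let (a_P)_P ∈ ∏_P R/(P) and suppose that α = [(a_P)_P] ∈ A_K is algebraic over K, i.e., there exists a nonzero polynomial f ∈ K[x] with f(α) = 0 in A_K. Then the set { x ∈ R : a_P = x mod P for infinitely many monic irreducible P } is finite. -/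
set_option synthInstance.maxHeartbeats 1000000
set_option maxHeartbeats 1000000

open Polynomial

noncomputable section

variable (Fq : Type) [Field Fq] [Fintype Fq]

/-- A polynomial with infinitely many monic irreducible divisors is zero. -/
theorem eq_zero_of_infinite_monicIrr_dvd {F : Type} [Field F] {N : Polynomial F}
    (h : {P : MonicIrr F | P.1 ∣ N}.Infinite) : N = 0 := by
  classical
  by_contra hN
  refine h (Set.Finite.of_finite_image (f := Subtype.val) ?_ Subtype.val_injective.injOn)
  refine (UniqueFactorizationMonoid.normalizedFactors N).toFinset.finite_toSet.subset ?_
  rintro _ ⟨P, hP, rfl⟩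
  rw [Finset.mem_coe, Multiset.mem_toFinset, Polynomial.mem_normalizedFactors_iff hN]
  exact ⟨P.2.2, P.2.1, hP⟩

/-- If `x * b = n` with `b, n ∈ R`, then every residue `c` of `x` modulo `P` satisfies
`n = c * b` modulo `P`. -/
theorem ModPEq.mk_eq_mul {F : Type} [Field F] {x : RatFunc F} {P : MonicIrr F} {c : ResField F P}
    (h : ModPEq F x P c) {n b : Polynomial F}
    (hx : x * algebraMap (Polynomial F) (RatFunc F) b
      = algebraMap (Polynomial F) (RatFunc F) n) :
    Ideal.Quotient.mk (Ideal.span ({P.1} : Set (Polynomial F))) n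
      = c * Ideal.Quotient.mk (Ideal.span ({P.1} : Set (Polynomial F))) b := by
  obtain ⟨r, s, hs, hrs, hc⟩ := h
  have hprime : (Ideal.span ({P.1} : Set (Polynomial F))).IsPrime :=
    (Ideal.span_singleton_prime P.2.2.ne_zero).2 P.2.2.prime
  have hs' : Ideal.Quotient.mk (Ideal.span ({P.1} : Set (Polynomial F))) s ≠ 0 := by
    rwa [Ne, Ideal.Quotient.eq_zero_iff_dvd]
  have key : n * s = r * b := by
    apply IsFractionRing.injective (Polynomial F) (RatFunc F)
    rw [map_mul, map_mul, ← hx, ← hrs]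
    ring
  apply mul_right_cancel₀ hs'
  rw [← map_mul, key, map_mul, hc]
  ring

/-- if `α = [(a_P)_P]` is algebraic over `K`, then only finitely many `x ∈ R`
satisfy `a_P = x mod P` for infinitely many `P`. -/
theorem statement16 (a : ∀ P : MonicIrr Fq, ResField Fq P)
    (f : Polynomial (RatFunc Fq)) (hf0 : f ≠ 0) (hf : PolyRoot Fq f (mkAK Fq a)) :
    {x : Polynomial Fq |
      {P : MonicIrr Fq |
        Ideal.Quotient.mk (Ideal.span ({P.1} : Set (Polynomial Fq))) x = a P}.Infinite}.Finite := by
  classical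
  set g := IsLocalization.integerNormalization (nonZeroDivisors (Polynomial Fq)) f
  obtain ⟨b, hbM, hb⟩ :=
    IsLocalization.integerNormalization_spec (nonZeroDivisors (Polynomial Fq)) f
  have hcoeff (j : ℕ) : f.coeff j * algebraMap (Polynomial Fq) (RatFunc Fq) b
      = algebraMap (Polynomial Fq) (RatFunc Fq) (g.coeff j) := by
    rw [← coeff_map, hb, coeff_smul, Algebra.smul_def, mul_comm]
  have hb0 : algebraMap (Polynomial Fq) (RatFunc Fq) b ≠ 0 :=
    IsLocalization.to_map_ne_zero_of_mem_nonZeroDivisors _ le_rfl hbM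
  have hg0 : g ≠ 0 := by
    intro h
    refine hf0 (Polynomial.ext fun j => ?_)
    simpa [h, hb0] using hcoeff j
  have hdeg : g.natDegree < f.natDegree + 1 := by
    refine Nat.lt_succ_of_le (natDegree_le_iff_coeff_eq_zero.2 fun j hj => ?_)
    have := hcoeff j
    rw [coeff_eq_zero_of_natDegree_lt hj, zero_mul] at this
    exact (IsFractionRing.injective (Polynomial Fq) (RatFunc Fq)) (by rw [← this, map_zero])
  obtain ⟨d, hd, hsum⟩ := hf
  choose c hcd hc using hd
  have hzero : (∑ j ∈ Finset.range (f.natDegree + 1), c j * a ^ j) ∈ finIdeal Fq := by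
    rw [← Ideal.Quotient.eq_zero_iff_mem, ← hsum, map_sum]
    refine Finset.sum_congr rfl fun j _ => ?_
    rw [map_mul, map_pow, ← hcd j]
    rfl
  refine (g.roots.toFinset.finite_toSet).subset fun x hx => ?_
  rw [Finset.mem_coe, Multiset.mem_toFinset, mem_roots hg0]
  have hbad : ({P : MonicIrr Fq | (∑ j ∈ Finset.range (f.natDegree + 1), c j * a ^ j) P ≠ 0} ∪
      ⋃ j ∈ Finset.range (f.natDegree + 1),
        {P : MonicIrr Fq | ¬ ModPEq Fq (f.coeff j) P (c j P)}).Finite :=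
    Set.Finite.union hzero (Set.Finite.biUnion (Finset.finite_toSet _) fun j _ => hc j)
  refine eq_zero_of_infinite_monicIrr_dvd ((Set.Infinite.sdiff hx hbad).mono ?_)
  rintro P ⟨hxP, hP⟩
  simp only [Set.mem_ofPred_eq] at hxP
  simp only [Set.mem_union, Set.mem_iUnion, Set.mem_ofPred_eq, not_or, not_exists, not_not] at hP
  obtain ⟨hP0, hPc⟩ := hP
  rw [Set.mem_ofPred_eq, ← Ideal.Quotient.eq_zero_iff_dvd, eval_eq_sum_range' hdeg, map_sum]
  rw [Finset.sum_apply] at hP0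
  calc _ = ∑ j ∈ Finset.range (f.natDegree + 1), (c j * a ^ j) P *
        Ideal.Quotient.mk (Ideal.span ({P.1} : Set (Polynomial Fq))) b := by
        refine Finset.sum_congr rfl fun j hj => ?_
        rw [map_mul, map_pow, hxP, (hPc j hj).mk_eq_mul (hcoeff j), Pi.mul_apply, Pi.pow_apply]
        ring
    _ = 0 := by rw [← Finset.sum_mul, hP0, zero_mul]
end
end

section
/- Let L/K be a finite Galois extension of fields with Γ = Gal(L/K), and let ψ : L ⊗_K L → Map(Γ, L) be the K-linear map determined by ψ(x ⊗ y)(τ) = x·τ(y). Let Γ act diagonally on L ⊗_K L by σ(x ⊗ y) = σ(x) ⊗ σ(y). Then for a ∈ L ⊗_K L, one has ψ(a) ∈ A(L) (i.e., ψ(a)(στσ⁻¹) = σ(ψ(a)(τ)) for all σ, τ ∈ Γ) if and only if a is fixed by the diagonal action of Γ. In other words, ψ restricts to a bijection from (L ⊗_K L)^Γ onto A(L). -/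
open scoped TensorProduct

/-- Bourbaki's canonical `K`-linear map `ψ : L ⊗_K L → Map(Gal(L/K), L)`,
`x ⊗ y ↦ (τ ↦ x · τ(y))`. -/
noncomputable def psi (K L : Type) [Field K] [Field L] [Algebra K L] :
    L ⊗[K] L →ₗ[K] ((L ≃ₐ[K] L) → L) :=
  TensorProduct.lift (LinearMap.mk₂ K
    (fun x y => fun τ : L ≃ₐ[K] L => x * τ y)
    (fun x₁ x₂ y => by funext τ; simp [add_mul])
    (fun c x y => by funext τ; simp [smul_mul_assoc])
    (fun x y₁ y₂ => by funext τ; simp [mul_add])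
    (fun c x y => by funext τ; simp [map_smul, mul_smul_comm]))

@[simp]
theorem psi_tmul (K L : Type) [Field K] [Field L] [Algebra K L] (x y : L) (τ : L ≃ₐ[K] L) :
    psi K L (x ⊗ₜ y) τ = x * τ y := rfl

theorem psi_map_mulLeft (K L : Type) [Field K] [Field L] [Algebra K L] (c : L) (a : L ⊗[K] L) :
    psi K L (TensorProduct.map (LinearMap.mulLeft K c) LinearMap.id a) = c • psi K L a := by
  induction a with
  | zero => simp
  | tmul x y => ext τ; simp [mul_assoc]
  | add a b ha hb => simp [ha, hb]

/-- `ψ` turns the diagonal action into twisted conjugation on `Map(Γ, L)`. -/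
theorem psi_map_diagonal (K L : Type) [Field K] [Field L] [Algebra K L] (σ τ : L ≃ₐ[K] L)
    (a : L ⊗[K] L) :
    psi K L (TensorProduct.map σ.toLinearMap σ.toLinearMap a) (σ * τ * σ⁻¹) =
      σ (psi K L a τ) := by
  induction a with
  | zero => simp
  | tmul x y => simp [AlgEquiv.mul_apply, AlgEquiv.aut_inv]
  | add a b ha hb => simp [ha, hb]

theorem psi_surjective (K L : Type) [Field K] [Field L] [Algebra K L] [FiniteDimensional K L] :
    Function.Surjective (psi K L) := by
  classical
  let S : Submodule L ((L ≃ₐ[K] L) → L) :=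
    { (LinearMap.range (psi K L)).toAddSubmonoid with
      smul_mem' := by
        rintro c _ ⟨a, rfl⟩
        exact ⟨_, psi_map_mulLeft K L c a⟩ }
  suffices hS : S = ⊤ by
    intro g
    have hg : g ∈ S := hS ▸ Submodule.mem_top
    exact hg
  by_contra hS
  obtain ⟨f, hf, hle⟩ := Submodule.exists_le_ker_of_lt_top S (lt_top_iff_ne_top.mpr hS)
  have hker (y : L) : ∑ τ : L ≃ₐ[K] L, f (Pi.single τ 1) * τ y = 0 := by
    have h : f (psi K L (1 ⊗ₜ y)) = 0 := hle ⟨_, rfl⟩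
    have hsingle (τ : L ≃ₐ[K] L) : (fun j => if τ = j then (1 : L) else 0) = Pi.single τ 1 := by
      ext j
      simp [Pi.single_apply, eq_comm]
    rw [LinearMap.pi_apply_eq_sum_univ f] at h
    simpa [hsingle, mul_comm] using h
  have hli : LinearIndependent L fun τ : L ≃ₐ[K] L => (τ : L →ₐ[K] L).toLinearMap :=
    (linearIndependent_algHom_toLinearMap K L L).comp _ AlgEquiv.coe_toAlgHom_injective
  have hzero := Fintype.linearIndependent_iff.mp hli (fun τ => f (Pi.single τ 1)) <| by
    ext y
    simpa using hker y
  exact hf (LinearMap.pi_ext' fun τ => LinearMap.ext_ring (by simpa using hzero τ))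

theorem psi_bijective (K L : Type) [Field K] [Field L] [Algebra K L] [FiniteDimensional K L]
    [IsGalois K L] : Function.Bijective (psi K L) := by
  have hrank : Module.finrank K (L ⊗[K] L) = Module.finrank K ((L ≃ₐ[K] L) → L) := by
    rw [Module.finrank_tensorProduct, Module.finrank_pi_fintype, Finset.sum_const,
      Finset.card_univ, ← Nat.card_eq_fintype_card, IsGalois.card_aut_eq_finrank, smul_eq_mul]
  exact ⟨(LinearMap.injective_iff_surjective_of_finrank_eq_finrank hrank).mpr
    (psi_surjective K L), psi_surjective K L⟩

theorem psi_equivariant_iff (K L : Type) [Field K] [Field L] [Algebra K L]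
    [FiniteDimensional K L] [IsGalois K L] (a : L ⊗[K] L) :
    (∀ σ τ : L ≃ₐ[K] L, psi K L a (σ * τ * σ⁻¹) = σ (psi K L a τ)) ↔
      ∀ σ : L ≃ₐ[K] L, TensorProduct.map σ.toLinearMap σ.toLinearMap a = a := by
  refine ⟨fun h σ => (psi_bijective K L).1 (funext fun τ => ?_), fun h σ τ => ?_⟩
  · obtain ⟨ρ, rfl⟩ := (MulAut.conj σ).surjective τ
    rw [MulAut.conj_apply, psi_map_diagonal, h]
  · rw [← psi_map_diagonal, h]

/-- under Bourbaki's isomorphism `ψ`, the `Γ`-invariants of `L ⊗_K L` (for the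
diagonal action) correspond exactly to `A(L)`; i.e. `ψ(a)` is conjugation-equivariant iff `a`
is fixed by the diagonal action, and `ψ` restricts to a bijection `(L ⊗_K L)^Γ ≃ A(L)`. -/
theorem statement17 (K L : Type) [Field K] [Field L] [Algebra K L]
    [FiniteDimensional K L] [IsGalois K L] :
    (∀ a : L ⊗[K] L,
      (∀ σ τ : L ≃ₐ[K] L, psi K L a (σ * τ * σ⁻¹) = σ (psi K L a τ)) ↔
      (∀ σ : L ≃ₐ[K] L,
        TensorProduct.map σ.toLinearMap σ.toLinearMap a = a)) ∧
    Set.BijOn (fun a => psi K L a)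
      {a : L ⊗[K] L | ∀ σ : L ≃ₐ[K] L, TensorProduct.map σ.toLinearMap σ.toLinearMap a = a}
      {g : (L ≃ₐ[K] L) → L | ∀ σ τ : L ≃ₐ[K] L, g (σ * τ * σ⁻¹) = σ (g τ)} := by
  refine ⟨psi_equivariant_iff K L, fun a ha => (psi_equivariant_iff K L a).mpr ha,
    (psi_bijective K L).1.injOn, fun g hg => ?_⟩
  obtain ⟨a, rfl⟩ := psi_surjective K L g
  exact ⟨a, (psi_equivariant_iff K L a).mp hg, rfl⟩
end

section
/- Let L/K be a finite Galois extension of fields with Γ = Gal(L/K) and put d = [L:K]. The K-linear map Tr : L ⊗_K L → L ⊗_K L determined by x ⊗ y ↦ Σ_{σ∈Γ} σ(x) ⊗ σ(y) maps L ⊗_K L onto the subspace (L ⊗_K L)^Γ of elements fixed by the diagonal Γ-action. Consequently, every a ∈ (L ⊗_K L)^Γ can be written as a = Σ_{i∈I} x_i ⊗ y_i for a finite index set I of size d², elements x_i, y_i ∈ L, and an action of Γ on I such that σ(x_i) = x_{σ(i)} and σ(y_i) = y_{σ(i)} for all σ ∈ Γ and i ∈ I. -/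
open scoped TensorProduct

section

variable {K L : Type*} [Field K] [Field L] [Algebra K L]

/-- Every element of `L ⊗[K] M` is a sum of `[L : K]` pure tensors. -/
theorem exists_eq_sum_fin_finrank_tmul [FiniteDimensional K L] {M : Type*} [AddCommGroup M]
    [Module K M] (b : L ⊗[K] M) :
    ∃ (u : Fin (Module.finrank K L) → L) (v : Fin (Module.finrank K L) → M),
      b = ∑ j, u j ⊗ₜ[K] v j := by
  obtain ⟨c, hc⟩ := TensorProduct.eq_repr_basis_left (Module.finBasis K L) b
  refine ⟨Module.finBasis K L, c, ?_⟩
  rw [← hc, Finsupp.sum_fintype _ _ fun _ => TensorProduct.tmul_zero _ _]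

/-- The diagonal action of an automorphism on `L ⊗[K] L` is multiplicative. -/
theorem map_toLinearMap_mul (σ : L ≃ₐ[K] L) (a b : L ⊗[K] L) :
    TensorProduct.map σ.toLinearMap σ.toLinearMap (a * b) =
      TensorProduct.map σ.toLinearMap σ.toLinearMap a *
        TensorProduct.map σ.toLinearMap σ.toLinearMap b :=
  map_mul (Algebra.TensorProduct.map σ.toAlgHom σ.toAlgHom) a b

/-- The trace of the product of `c ⊗ 1` and an invariant `a` is `a` when `c` has trace `1`. -/
theorem sum_map_tmul_one_mul_of_trace_eq_one [FiniteDimensional K L] [IsGalois K L]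
    {c : L} (hc : Algebra.trace K L c = 1) {a : L ⊗[K] L}
    (ha : ∀ σ : L ≃ₐ[K] L, TensorProduct.map σ.toLinearMap σ.toLinearMap a = a) :
    ∑ σ : L ≃ₐ[K] L,
      TensorProduct.map σ.toLinearMap σ.toLinearMap ((c ⊗ₜ[K] (1 : L)) * a) = a := by
  have hsum : ∑ σ : L ≃ₐ[K] L, σ c = 1 := by
    rw [← trace_eq_sum_automorphisms, hc, map_one]
  simp only [map_toLinearMap_mul, ha, TensorProduct.map_tmul, AlgEquiv.toLinearMap_apply,
    map_one]
  rw [← Finset.sum_mul, ← TensorProduct.sum_tmul, hsum, ← Algebra.TensorProduct.one_def,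
    one_mul]

/-- The trace of any tensor is invariant under the diagonal action. -/
theorem map_sum_map_eq [FiniteDimensional K L] (σ : L ≃ₐ[K] L) (b : L ⊗[K] L) :
    TensorProduct.map σ.toLinearMap σ.toLinearMap
        (∑ τ : L ≃ₐ[K] L, TensorProduct.map τ.toLinearMap τ.toLinearMap b) =
      ∑ τ : L ≃ₐ[K] L, TensorProduct.map τ.toLinearMap τ.toLinearMap b := by
  rw [map_sum]
  refine Fintype.sum_equiv (Equiv.mulLeft σ) _ _ fun τ => ?_
  rw [← LinearMap.comp_apply, ← TensorProduct.map_comp]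
  rfl

end

/-- the trace map `Tr : L ⊗_K L → L ⊗_K L`, `x ⊗ y ↦ Σ_σ σ(x) ⊗ σ(y)`, maps
onto the `Γ`-invariants; consequently every `Γ`-invariant element can be written as
`Σ_{i ∈ I} x_i ⊗ y_i` with `#I = d²` and `Γ` acting on the indices of `x_i` and `y_i`
in the same way. -/
theorem statement18 (K L : Type) [Field K] [Field L] [Algebra K L]
    [FiniteDimensional K L] [IsGalois K L] :
    (Set.range (fun a : L ⊗[K] L =>
        ∑ σ : L ≃ₐ[K] L, TensorProduct.map σ.toLinearMap σ.toLinearMap a)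
      = {a : L ⊗[K] L | ∀ σ : L ≃ₐ[K] L,
          TensorProduct.map σ.toLinearMap σ.toLinearMap a = a}) ∧
    ∀ a : L ⊗[K] L,
      (∀ σ : L ≃ₐ[K] L, TensorProduct.map σ.toLinearMap σ.toLinearMap a = a) →
      ∃ (x y : Fin (Module.finrank K L ^ 2) → L)
        (act : (L ≃ₐ[K] L) →* Equiv.Perm (Fin (Module.finrank K L ^ 2))),
        a = ∑ i : Fin (Module.finrank K L ^ 2), x i ⊗ₜ[K] y i ∧
        ∀ (σ : L ≃ₐ[K] L) (i : Fin (Module.finrank K L ^ 2)),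
          σ (x i) = x (act σ i) ∧ σ (y i) = y (act σ i) := by
  obtain ⟨c, hc⟩ := Algebra.trace_surjective K L 1
  refine ⟨?_, fun a ha => ?_⟩
  · ext a
    constructor
    · rintro ⟨b, rfl⟩ σ
      exact map_sum_map_eq σ b
    · exact fun ha => ⟨_, sum_map_tmul_one_mul_of_trace_eq_one hc ha⟩
  · obtain ⟨u, v, huv⟩ := exists_eq_sum_fin_finrank_tmul ((c ⊗ₜ[K] (1 : L)) * a)
    have hcard : Fintype.card ((L ≃ₐ[K] L) × Fin (Module.finrank K L)) =
        Module.finrank K L ^ 2 := by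
      rw [Fintype.card_prod, Fintype.card_fin, ← Nat.card_eq_fintype_card,
        IsGalois.card_aut_eq_finrank, sq]
    let e := Fintype.equivFinOfCardEq hcard
    let leftMul : (L ≃ₐ[K] L) →* Equiv.Perm ((L ≃ₐ[K] L) × Fin (Module.finrank K L)) :=
      { toFun σ := (Equiv.mulLeft σ).prodCongr (Equiv.refl _)
        map_one' := by ext <;> simp
        map_mul' σ τ := by ext <;> simp }
    refine ⟨fun i => (e.symm i).1 (u (e.symm i).2), fun i => (e.symm i).1 (v (e.symm i).2),
      e.permCongrHom.toMonoidHom.comp leftMul, ?_, fun σ i => ?_⟩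
    · rw [Equiv.sum_comp e.symm fun p => p.1 (u p.2) ⊗ₜ[K] p.1 (v p.2),
        Fintype.sum_prod_type, ← sum_map_tmul_one_mul_of_trace_eq_one hc ha, huv]
      simp
    · simp [leftMul, Equiv.permCongrHom]
end
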